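/- arXiv:math/0601524 — 3 statements merged into one kernel-verified Lean document; each statement's English description precedes it below -/
import Mathlib

section
/- For probability measures P, Q on S, q(P,Q) = inf{ρ(X,Y) : X, Y are S-valued random variables on (Ω,𝓕,P) with law(X) = P and law(Y) = Q}, where the infimum is over random variables on a fixed nonatomic probability space. -/
open MeasureTheory Filter Topology Set
open scoped ENNReal NNReal

/-- The Ky Fan distance between two `S`-valued random variables on `(Ω, P)`:
`inf {ε > 0 : P{ω : d(X ω, Y ω) ≥ ε} ≤ ε}`. -/
noncomputable def kyFanDist {Ω S : Type*} [MeasurableSpace Ω] [PseudoMetricSpace S]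
    (P : Measure Ω) (X Y : Ω → S) : ℝ :=
  sInf {ε : ℝ | 0 < ε ∧ (P {ω | ε ≤ dist (X ω) (Y ω)}).toReal ≤ ε}

/-- A measure is nonatomic if every set of positive measure contains a measurable
subset of strictly smaller positive measure. -/
def Nonatomic {Ω : Type*} [MeasurableSpace Ω] (P : Measure Ω) : Prop :=
  ∀ A : Set Ω, MeasurableSet A → 0 < P A →
    ∃ B ⊆ A, MeasurableSet B ∧ 0 < P B ∧ P B < P A

/-- A finitely supported measure: a finite convex combination of Dirac measures. -/
def FinitelySupported {S : Type*} [MeasurableSpace S] (μ : Measure S) : Prop :=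
  ∃ (n : ℕ) (c : Fin n → ℝ≥0∞) (a : Fin n → S),
    (∑ i, c i) = 1 ∧ μ = ∑ i, c i • Measure.dirac (a i)

/-- Continuity of a path of random variables with respect to the Ky Fan metric
(equivalently, the topology of convergence in probability). -/
def KyFanContinuousOn {Ω S : Type*} [MeasurableSpace Ω] [PseudoMetricSpace S]
    (P : Measure Ω) (γ : ℝ → Ω → S) (A : Set ℝ) : Prop :=
  ∀ t ∈ A, ∀ ε > 0, ∃ δ > 0, ∀ s ∈ A, |s - t| < δ → kyFanDist P (γ s) (γ t) < ε

/-- Continuity of a path of measures with respect to the Lévy–Prokhorov metric. -/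
def LPContinuousOn {S : Type*} [MeasurableSpace S] [PseudoMetricSpace S]
    (α : ℝ → Measure S) (A : Set ℝ) : Prop :=
  ∀ t ∈ A, ∀ ε > 0, ∃ δ > 0, ∀ s ∈ A, |s - t| < δ → levyProkhorovDist (α s) (α t) < ε

/-- A polygonal path in the space of measures with vertices in `V`: there is a partition
`0 = t₀ < t₁ < ⋯ < t_{n+1} = 1` and vertices `μᵢ ∈ V` such that on `[tᵢ, tᵢ₊₁]` the path
is the affine interpolation of `μᵢ` and `μᵢ₊₁`. -/
def IsPolygonalWithVertices {S : Type*} [MeasurableSpace S] (β : ℝ → Measure S)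
    (V : Set (Measure S)) : Prop :=
  ∃ (n : ℕ) (t : Fin (n + 2) → ℝ) (μ : Fin (n + 2) → Measure S),
    StrictMono t ∧ t 0 = 0 ∧ t (Fin.last (n + 1)) = 1 ∧ (∀ i, μ i ∈ V) ∧
    ∀ (i : Fin (n + 1)), ∀ s ∈ Set.Icc (t i.castSucc) (t i.succ),
      β s = ENNReal.ofReal ((t i.succ - s) / (t i.succ - t i.castSucc)) • μ i.castSucc
        + ENNReal.ofReal ((s - t i.castSucc) / (t i.succ - t i.castSucc)) • μ i.succ


section NonatomicPart
variable {Ω : Type*} [MeasurableSpace Ω]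

lemma nonatomic_small (μ : Measure Ω) [IsProbabilityMeasure μ] (hna : Nonatomic μ)
    (A : Set Ω) (hA : MeasurableSet A) (hpos : 0 < μ.real A) (n : ℕ) :
    ∃ B ⊆ A, MeasurableSet B ∧ 0 < μ.real B ∧ μ.real B ≤ μ.real A / 2 ^ n := by
  induction n with
  | zero => exact ⟨A, subset_rfl, hA, hpos, by simp⟩
  | succ n ih =>
    obtain ⟨B, hBA, hB, hBpos, hBle⟩ := ih
    obtain ⟨C, hCB, hC, hCpos, hClt⟩ := hna B hB (by
      rw [measureReal_def] at hBpos
      exact (ENNReal.toReal_pos_iff.1 hBpos).1)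
    have h1 : 0 < μ.real C := ENNReal.toReal_pos hCpos.ne' (measure_ne_top _ _)
    have h2 : μ.real C < μ.real B :=
      (ENNReal.toReal_lt_toReal (measure_ne_top _ _) (measure_ne_top _ _)).2 hClt
    have h3 : μ.real (B \ C) = μ.real B - μ.real C := measureReal_sdiff hCB hC
    have h4 : μ.real A / 2 ^ (n + 1) = μ.real A / 2 ^ n / 2 := by
      rw [pow_succ]; field_simp
    rw [h4]
    by_cases h : μ.real C ≤ μ.real B / 2
    · exact ⟨C, hCB.trans hBA, hC, h1, by linarith⟩
    · exact ⟨B \ C, sdiff_subset.trans hBA, hB.diff hC, by linarith, by linarith⟩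

lemma nonatomic_small' (μ : Measure Ω) [IsProbabilityMeasure μ] (hna : Nonatomic μ)
    (A : Set Ω) (hA : MeasurableSet A) (hpos : 0 < μ.real A) (ε : ℝ) (hε : 0 < ε) :
    ∃ B ⊆ A, MeasurableSet B ∧ 0 < μ.real B ∧ μ.real B ≤ ε := by
  obtain ⟨n, hn⟩ := exists_pow_lt_of_lt_one hε (by norm_num : (1 / 2 : ℝ) < 1)
  obtain ⟨B, h1, h2, h3, h4⟩ := nonatomic_small μ hna A hA hpos n
  refine ⟨B, h1, h2, h3, h4.trans ?_⟩
  have h5 : μ.real A ≤ 1 := measureReal_le_one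
  calc μ.real A / 2 ^ n ≤ 1 / 2 ^ n := by gcongr
    _ = (1 / 2 : ℝ) ^ n := by simp
    _ ≤ ε := hn.le

lemma sierpinski_step (μ : Measure Ω) [IsProbabilityMeasure μ]
    (A : Set Ω) (hA : MeasurableSet A) (c : ℝ) (B : Set Ω) (hB : MeasurableSet B) (hBA : B ⊆ A)
    (hBc : μ.real B ≤ c) :
    ∃ B', MeasurableSet B' ∧ B' ⊆ A ∧ μ.real B' ≤ c ∧ B ⊆ B' ∧
      ∀ D, MeasurableSet D → D ⊆ A \ B → μ.real B + μ.real D ≤ c →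
        μ.real D ≤ 2 * (μ.real B' - μ.real B) := by
  let T : Set ℝ := {r | ∃ D, MeasurableSet D ∧ D ⊆ A \ B ∧ μ.real B + μ.real D ≤ c ∧ r = μ.real D}
  have hT0 : (0 : ℝ) ∈ T := ⟨∅, MeasurableSet.empty, empty_subset _, by simpa using hBc, by simp⟩
  have hTb : BddAbove T := ⟨1, by rintro r ⟨D, -, -, -, rfl⟩; exact measureReal_le_one⟩
  have hs0 : 0 ≤ sSup T := le_csSup hTb hT0
  have : ∃ r ∈ T, sSup T ≤ 2 * r := by
    rcases hs0.eq_or_lt with h | h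
    · exact ⟨0, hT0, by rw [← h]; simp⟩
    · obtain ⟨r, hr, hlt⟩ := exists_lt_of_lt_csSup ⟨0, hT0⟩ (half_lt_self h)
      exact ⟨r, hr, by linarith⟩
  obtain ⟨r, ⟨C, hC, hCA, hCc, rfl⟩, hr⟩ := this
  have hdis : Disjoint B C := disjoint_left.2 fun x hx hx' => (hCA hx').2 hx
  have hU : μ.real (B ∪ C) = μ.real B + μ.real C := measureReal_union hdis hC
  refine ⟨B ∪ C, hB.union hC, union_subset hBA (hCA.trans sdiff_subset), by rw [hU]; exact hCc,
    subset_union_left, ?_⟩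
  intro D hD hDA hDc
  have := le_csSup hTb (show μ.real D ∈ T from ⟨D, hD, hDA, hDc, rfl⟩)
  rw [hU]; linarith

lemma sierpinski (μ : Measure Ω) [IsProbabilityMeasure μ] (hna : Nonatomic μ)
    (A : Set Ω) (hA : MeasurableSet A) (c : ℝ) (hc0 : 0 ≤ c) (hc : c ≤ μ.real A) :
    ∃ B ⊆ A, MeasurableSet B ∧ μ.real B = c := by
  let T := {B : Set Ω // MeasurableSet B ∧ B ⊆ A ∧ μ.real B ≤ c}
  have step : ∀ B : T, ∃ B' : T, B.1 ⊆ B'.1 ∧ ∀ D, MeasurableSet D → D ⊆ A \ B.1 →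
      μ.real B.1 + μ.real D ≤ c → μ.real D ≤ 2 * (μ.real B'.1 - μ.real B.1) := by
    rintro ⟨B, h1, h2, h3⟩
    obtain ⟨B', a, b, d, e, f⟩ := sierpinski_step μ A hA c B h1 h2 h3
    exact ⟨⟨B', a, b, d⟩, e, f⟩
  choose f hf1 hf2 using step
  let b : ℕ → T := fun n => f^[n] ⟨∅, MeasurableSet.empty, empty_subset _, by simpa using hc0⟩
  have hb : ∀ n, b (n + 1) = f (b n) := fun n => Function.iterate_succ_apply' _ _ _
  have hmono : Monotone fun n => (b n).1 := monotone_nat_of_le_succ fun n => by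
    rw [hb]; exact hf1 _
  let L := ⋃ n, (b n).1
  have hL : MeasurableSet L := MeasurableSet.iUnion fun n => (b n).2.1
  have hLA : L ⊆ A := iUnion_subset fun n => (b n).2.2.1
  have hlim : Tendsto (fun n => μ.real (b n).1) atTop (𝓝 (μ.real L)) :=
    (ENNReal.tendsto_toReal (measure_ne_top _ _)).comp (tendsto_measure_iUnion_atTop hmono)
  have hLc : μ.real L ≤ c := le_of_tendsto' hlim fun n => (b n).2.2.2
  refine ⟨L, hLA, hL, ?_⟩
  by_contra hne
  have hlt : μ.real L < c := lt_of_le_of_ne hLc hne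
  have hd : μ.real (A \ L) = μ.real A - μ.real L := measureReal_sdiff hLA hL
  obtain ⟨D, hDA, hD, hDpos, hDle⟩ := nonatomic_small' μ hna (A \ L) (hA.diff hL) (by linarith)
    (c - μ.real L) (by linarith)
  have hlim2 : Tendsto (fun n => 2 * (μ.real (b (n + 1)).1 - μ.real (b n).1)) atTop
      (𝓝 (2 * (μ.real L - μ.real L))) :=
    ((hlim.comp (tendsto_add_atTop_nat 1)).sub hlim).const_mul 2
  have : μ.real D ≤ 2 * (μ.real L - μ.real L) := ge_of_tendsto' hlim2 fun n => by
    have hsub : (b n).1 ⊆ L := subset_iUnion (fun n => (b n).1) n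
    have : μ.real (b n).1 ≤ μ.real L := measureReal_mono hsub
    rw [hb]
    exact hf2 (b n) D hD (hDA.trans (sdiff_subset_sdiff_right hsub)) (by linarith)
  linarith

lemma bit_step (μ : Measure Ω) [IsProbabilityMeasure μ] (hna : Nonatomic μ) (X : Ω → ℕ)
    (hX : Measurable X) : ∃ X' : Ω → ℕ, Measurable X' ∧ (∀ ω, X' ω / 2 = X ω) ∧
      ∀ k, μ.real {ω | X' ω = 2 * k} = μ.real {ω | X ω = k} / 2 := by
  have hm : ∀ k, MeasurableSet {ω | X ω = k} := fun k => hX (measurableSet_singleton k)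
  have : ∀ k, ∃ B ⊆ {ω | X ω = k}, MeasurableSet B ∧ μ.real B = μ.real {ω | X ω = k} / 2 := by
    intro k
    have : 0 ≤ μ.real {ω | X ω = k} := measureReal_nonneg
    exact sierpinski μ hna _ (hm k) _ (by linarith) (by linarith)
  choose B hBs hBm hB using this
  classical
  let X' : Ω → ℕ := fun ω => if ω ∈ B (X ω) then 2 * X ω else 2 * X ω + 1
  have he : ∀ k, {ω | X' ω = 2 * k} = B k := by
    intro k
    ext ω
    simp only [X', mem_ofPred_eq]
    constructor
    · intro h
      split_ifs at h with h'
      · have : X ω = k := by omega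
        rwa [this] at h'
      · omega
    · intro h
      have : X ω = k := hBs k h
      simp [this, h]
  have ho : ∀ k, {ω | X' ω = 2 * k + 1} = {ω | X ω = k} \ B k := by
    intro k
    ext ω
    simp only [X', mem_ofPred_eq, Set.mem_sdiff]
    constructor
    · intro h
      split_ifs at h with h'
      · omega
      · have : X ω = k := by omega
        exact ⟨this, by rwa [this] at h'⟩
    · rintro ⟨h1, h2⟩
      simp [h1, h2]
  refine ⟨X', measurable_to_countable' fun m => ?_, ?_, ?_⟩
  · change MeasurableSet {ω | X' ω = m}
    obtain ⟨k, rfl | rfl⟩ := Nat.even_or_odd' m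
    · rw [he]; exact hBm k
    · rw [ho]; exact (hm k).diff (hBm k)
  · intro ω
    simp only [X']
    split_ifs <;> omega
  · intro k; rw [he, hB]

lemma exists_digits (μ : Measure Ω) [IsProbabilityMeasure μ] (hna : Nonatomic μ) :
    ∃ X : ℕ → Ω → ℕ, (∀ n, Measurable (X n)) ∧ (∀ n ω, X (n + 1) ω / 2 = X n ω) ∧
      (∀ n ω, X n ω < 2 ^ n) ∧
      ∀ n k, k ≤ 2 ^ n → μ.real {ω | X n ω < k} = k / 2 ^ n := by
  have step : ∀ X : {X : Ω → ℕ // Measurable X}, ∃ X' : {X : Ω → ℕ // Measurable X},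
      (∀ ω, X'.1 ω / 2 = X.1 ω) ∧
      ∀ k, μ.real {ω | X'.1 ω = 2 * k} = μ.real {ω | X.1 ω = k} / 2 := by
    rintro ⟨X, hX⟩
    obtain ⟨X', h, h'⟩ := bit_step μ hna X hX
    exact ⟨⟨X', h⟩, h'⟩
  choose f hf1 hf2 using step
  let b : ℕ → {X : Ω → ℕ // Measurable X} := fun n => f^[n] ⟨fun _ => 0, measurable_const⟩
  have hb : ∀ n, b (n + 1) = f (b n) := fun n => Function.iterate_succ_apply' _ _ _
  have hdiv : ∀ n ω, (b (n + 1)).1 ω / 2 = (b n).1 ω := fun n ω => by rw [hb]; exact hf1 _ _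
  refine ⟨fun n => (b n).1, fun n => (b n).2, hdiv, ?_, ?_⟩
  · intro n ω
    induction n with
    | zero => simp [b]
    | succ n ih =>
      have := hdiv n ω
      have ih' : (b n).1 ω < 2 ^ n := ih
      change (b (n + 1)).1 ω < 2 ^ (n + 1)
      rw [pow_succ]
      omega
  · intro n
    induction n with
    | zero =>
      intro k hk
      have : k = 0 ∨ k = 1 := by simp at hk; omega
      rcases this with rfl | rfl
      · simp
      · simp [b]
    | succ n ih =>
      intro m hm
      have hsucc : ∀ (Y : Ω → ℕ) (hY : Measurable Y) (k : ℕ),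
          μ.real {ω | Y ω < k + 1} = μ.real {ω | Y ω < k} + μ.real {ω | Y ω = k} := by
        intro Y hY k
        rw [← measureReal_union]
        · congr 1; ext ω; simp only [mem_ofPred_eq, mem_union]; omega
        · exact disjoint_left.2 fun x (hx : Y x < k) (hx' : Y x = k) => by omega
        · exact hY (measurableSet_singleton k)
      have heven : ∀ k, {ω | (b (n + 1)).1 ω < 2 * k} = {ω | (b n).1 ω < k} := by
        intro k; ext ω
        have := hdiv n ω
        simp only [mem_ofPred_eq]; omega
      obtain ⟨k, rfl | rfl⟩ := Nat.even_or_odd' m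
      · rw [heven, ih k (by rw [pow_succ] at hm; omega)]
        push_cast; rw [pow_succ]; field_simp
      · have h1 := ih k (by rw [pow_succ] at hm; omega)
        have h2 := ih (k + 1) (by rw [pow_succ] at hm; omega)
        rw [hsucc _ (b n).2] at h2
        have h3 : μ.real {ω | (b (n + 1)).1 ω = 2 * k} = μ.real {ω | (b n).1 ω = k} / 2 := by
          rw [hb]; exact hf2 _ _
        rw [hsucc _ (b (n + 1)).2, heven, h3, h1]
        have h4 : μ.real {ω | (b n).1 ω = k} = 1 / 2 ^ n := by
          rw [h1] at h2; push_cast at h2; rw [add_div] at h2; linarith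
        rw [h4]; push_cast; rw [pow_succ]; field_simp

lemma exists_uniform (μ : Measure Ω) [IsProbabilityMeasure μ] (hna : Nonatomic μ) :
    ∃ U : Ω → unitInterval, Measurable U ∧ μ.map U = volume := by
  obtain ⟨X, hXm, hdiv, hlt, hlaw⟩ := exists_digits μ hna
  let x : ℕ → Ω → ℝ := fun n ω => X n ω / 2 ^ n
  let y : ℕ → Ω → ℝ := fun n ω => (X n ω + 1) / 2 ^ n
  have hx : ∀ ω, Monotone fun n => x n ω := fun ω => monotone_nat_of_le_succ fun n => by
    have h1 : 2 * X n ω ≤ X (n + 1) ω := by have := hdiv n ω; omega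
    have h2 : (2 * X n ω : ℝ) ≤ X (n + 1) ω := by exact_mod_cast h1
    simp only [x]
    rw [pow_succ, div_le_div_iff₀ (by positivity) (by positivity)]
    nlinarith [show (0 : ℝ) < 2 ^ n by positivity]
  have hy : ∀ ω, Antitone fun n => y n ω := fun ω => antitone_nat_of_succ_le fun n => by
    have h1 : X (n + 1) ω + 1 ≤ 2 * (X n ω + 1) := by have := hdiv n ω; omega
    have h2 : (X (n + 1) ω + 1 : ℝ) ≤ 2 * (X n ω + 1) := by exact_mod_cast h1
    simp only [y]
    rw [pow_succ, div_le_div_iff₀ (by positivity) (by positivity)]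
    nlinarith [show (0 : ℝ) < 2 ^ n by positivity]
  have hxy : ∀ n m ω, x n ω ≤ y m ω := fun n m ω => by
    calc x n ω ≤ x (max n m) ω := hx ω (le_max_left _ _)
      _ ≤ y (max n m) ω := by simp only [x, y]; gcongr; linarith
      _ ≤ y m ω := hy ω (le_max_right _ _)
  let u : Ω → ℝ := fun ω => ⨆ n, x n ω
  have hbdd : ∀ ω, BddAbove (range fun n => x n ω) := fun ω =>
    ⟨y 0 ω, by rintro _ ⟨n, rfl⟩; exact hxy _ _ _⟩
  have hxu : ∀ n ω, x n ω ≤ u ω := fun n ω => le_ciSup (hbdd ω) n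
  have huy : ∀ n ω, u ω ≤ y n ω := fun n ω => ciSup_le fun m => hxy m n ω
  have hum : Measurable u := by
    refine Measurable.iSup fun n => ?_
    have : Measurable fun ω => (X n ω : ℝ) := (measurable_from_nat (f := fun k : ℕ => (k : ℝ))).comp (hXm n)
    exact this.div_const _
  have hu0 : ∀ ω, u ω ∈ unitInterval := fun ω => by
    have h := hlt 0 ω
    have h' : X 0 ω = 0 := by simpa using h
    have h1 := hxu 0 ω
    have h2 := huy 0 ω
    simp [x, y, h'] at h1 h2
    exact ⟨h1, h2⟩
  have hUm : Measurable fun ω => (⟨u ω, hu0 ω⟩ : unitInterval) := hum.subtype_mk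
  refine ⟨fun ω => ⟨u ω, hu0 ω⟩, hUm, ?_⟩
  have : IsProbabilityMeasure (μ.map fun ω => (⟨u ω, hu0 ω⟩ : unitInterval)) :=
    Measure.isProbabilityMeasure_map hUm.aemeasurable
  refine Measure.ext_of_Iic _ _ fun t => ?_
  rw [Measure.map_apply hUm measurableSet_Iic, unitInterval.volume_Iic]
  have hset : (fun ω => (⟨u ω, hu0 ω⟩ : unitInterval)) ⁻¹' Iic t = {ω | u ω ≤ t} := by
    ext ω; rfl
  rw [hset, ← ofReal_measureReal]
  congr 1
  have hp : Tendsto (fun n : ℕ => (1 / 2 : ℝ) ^ n) atTop (𝓝 0) :=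
    tendsto_pow_atTop_nhds_zero_of_lt_one (by norm_num) (by norm_num)
  have ht0 : 0 ≤ (t : ℝ) := t.2.1
  have ht1 : (t : ℝ) ≤ 1 := t.2.2
  have hpow : ∀ n : ℕ, (1 / 2 : ℝ) ^ n = 1 / 2 ^ n := fun n => by simp
  apply le_antisymm
  · have : Tendsto (fun n : ℕ => (t : ℝ) + (1 / 2 : ℝ) ^ n) atTop (𝓝 ((t : ℝ) + 0)) := hp.const_add _
    rw [add_zero] at this
    refine ge_of_tendsto' this fun n => ?_
    by_cases hk : ⌊(t : ℝ) * 2 ^ n⌋₊ + 1 ≤ 2 ^ n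
    · calc μ.real {ω | u ω ≤ t} ≤ μ.real {ω | X n ω < ⌊(t : ℝ) * 2 ^ n⌋₊ + 1} := by
            refine measureReal_mono fun ω hω => ?_
            have h1 : x n ω ≤ t := (hxu n ω).trans hω
            simp only [x] at h1
            rw [div_le_iff₀ (by positivity)] at h1
            exact Nat.lt_succ_of_le (Nat.le_floor h1)
        _ = (⌊(t : ℝ) * 2 ^ n⌋₊ + 1) / 2 ^ n := by rw [hlaw n _ hk]; push_cast; rfl
        _ ≤ ((t : ℝ) * 2 ^ n + 1) / 2 ^ n := by
            gcongr
            exact Nat.floor_le (by positivity)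
        _ = t + (1 / 2 : ℝ) ^ n := by rw [hpow]; field_simp
    · have h1 : (2 : ℝ) ^ n ≤ t * 2 ^ n := by
        have h2 : 2 ^ n ≤ ⌊(t : ℝ) * 2 ^ n⌋₊ := by omega
        have h3 : ((2 ^ n : ℕ) : ℝ) ≤ ⌊(t : ℝ) * 2 ^ n⌋₊ := by exact_mod_cast h2
        push_cast at h3
        exact h3.trans (Nat.floor_le (by positivity))
      have h2 : (1 : ℝ) ≤ t := by
        have : (0 : ℝ) < 2 ^ n := by positivity
        by_contra h; push Not at h; nlinarith
      have h3 : μ.real {ω | u ω ≤ t} ≤ 1 := measureReal_le_one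
      have h4 : (0 : ℝ) ≤ (1 / 2) ^ n := by positivity
      linarith
  · have : Tendsto (fun n : ℕ => (t : ℝ) - (1 / 2 : ℝ) ^ n) atTop (𝓝 ((t : ℝ) - 0)) := hp.const_sub _
    rw [sub_zero] at this
    refine le_of_tendsto' this fun n => ?_
    have hfl : (⌊(t : ℝ) * 2 ^ n⌋₊ : ℝ) ≤ t * 2 ^ n := Nat.floor_le (by positivity)
    have hk : ⌊(t : ℝ) * 2 ^ n⌋₊ ≤ 2 ^ n := by
      have h1 : (⌊(t : ℝ) * 2 ^ n⌋₊ : ℝ) ≤ 2 ^ n := by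
        nlinarith [show (0 : ℝ) < 2 ^ n by positivity]
      exact_mod_cast h1
    calc (t : ℝ) - (1 / 2 : ℝ) ^ n = ((t : ℝ) * 2 ^ n - 1) / 2 ^ n := by rw [hpow]; field_simp
      _ ≤ (⌊(t : ℝ) * 2 ^ n⌋₊ : ℝ) / 2 ^ n := by
          gcongr
          exact (Nat.sub_one_lt_floor _).le
      _ = μ.real {ω | X n ω < ⌊(t : ℝ) * 2 ^ n⌋₊} := (hlaw n _ hk).symm
      _ ≤ μ.real {ω | u ω ≤ t} := by
          refine measureReal_mono fun ω hω => ?_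
          refine (huy n ω).trans ?_
          simp only [y]
          rw [div_le_iff₀ (by positivity)]
          have : ((X n ω + 1 : ℕ) : ℝ) ≤ ⌊(t : ℝ) * 2 ^ n⌋₊ := by exact_mod_cast hω
          push_cast at this
          linarith

lemma exists_rv_law (μ : Measure Ω) [IsProbabilityMeasure μ] (hna : Nonatomic μ)
    {Y : Type*} [MeasurableSpace Y] [StandardBorelSpace Y] [Nonempty Y]
    (π : Measure Y) [IsProbabilityMeasure π] :
    ∃ Z : Ω → Y, Measurable Z ∧ μ.map Z = π := by
  obtain ⟨U, hU, hUl⟩ := exists_uniform μ hna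
  obtain ⟨g, hg, hgl⟩ := Measure.exists_measurable_map_eq π
  exact ⟨g ∘ U, hg.comp hU, by rw [← Measure.map_map hg hU, hUl, hgl]⟩

end NonatomicPart

lemma transport {ι : Type*} [Fintype ι] (p q : ι → ℝ) (hp : ∀ i, 0 ≤ p i) (hq : ∀ i, 0 ≤ q i)
    (R : ι → ι → Prop) (η : ℝ) (hη : 0 ≤ η)
    (hall : ∀ (I J : Finset ι), (∀ j, j ∈ J ↔ ∃ i ∈ I, R i j) →
      ∑ i ∈ I, p i ≤ ∑ j ∈ J, q j + η) (N : ℕ) (hN : 0 < N) :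
    ∃ m : ι → ι → ℝ, (∀ i j, 0 ≤ m i j) ∧ (∀ i j, m i j ≠ 0 → R i j) ∧
      (∀ i, ∑ j, m i j ≤ p i) ∧ (∀ j, ∑ i, m i j ≤ q j) ∧
      ∑ i, p i - η - (2 * Fintype.card ι + 1) / N ≤ ∑ i, ∑ j, m i j := by
  classical
  have hN' : (0 : ℝ) < N := by exact_mod_cast hN
  let a : ι → ℕ := fun i => ⌊N * p i⌋₊
  let b : ι → ℕ := fun i => ⌊N * q i⌋₊
  have ha : ∀ i, (a i : ℝ) ≤ N * p i := fun i => Nat.floor_le (by have := hp i; positivity)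
  have ha' : ∀ i, N * p i - 1 ≤ (a i : ℝ) := fun i => (Nat.sub_one_lt_floor _).le
  have hb : ∀ i, (b i : ℝ) ≤ N * q i := fun i => Nat.floor_le (by have := hq i; positivity)
  have hb' : ∀ i, N * q i - 1 ≤ (b i : ℝ) := fun i => (Nat.sub_one_lt_floor _).le
  let D : ℕ := ⌈N * η⌉₊ + Fintype.card ι
  have hD : N * η + Fintype.card ι ≤ (D : ℝ) := by
    simp only [D]; push_cast; gcongr; exact Nat.le_ceil _
  have hD' : (D : ℝ) ≤ N * η + 1 + Fintype.card ι := by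
    simp only [D]; push_cast; gcongr; exact (Nat.ceil_lt_add_one (by positivity)).le
  let α := Σ i, Fin (a i)
  let β := (Σ i, Fin (b i)) ⊕ Fin D
  let r : α → β → Prop := fun x y => match y with
    | Sum.inl z => R x.1 z.1
    | Sum.inr _ => True
  obtain ⟨f, hfinj, hfr⟩ := (Fintype.all_card_le_filter_rel_iff_exists_injective r).1 (by
    intro T
    rcases T.eq_empty_or_nonempty with rfl | ⟨t0, ht0⟩
    · simp
    let I : Finset ι := T.image Sigma.fst
    let J : Finset ι := Finset.univ.filter fun j => ∃ i ∈ I, R i j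
    have h1 : T.card ≤ ∑ i ∈ I, a i := by
      calc T.card ≤ (I.sigma fun i => (Finset.univ : Finset (Fin (a i)))).card := by
            refine Finset.card_le_card fun x hx => ?_
            exact Finset.mem_sigma.2 ⟨Finset.mem_image_of_mem Sigma.fst hx, Finset.mem_univ _⟩
        _ = ∑ i ∈ I, a i := by simp [Finset.card_sigma]
    have h2 : ∑ j ∈ J, b j + D ≤ (Finset.univ.filter fun y => ∃ x ∈ T, r x y).card := by
      calc ∑ j ∈ J, b j + D
          = ((J.sigma fun i => (Finset.univ : Finset (Fin (b i)))).disjSum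
              (Finset.univ : Finset (Fin D))).card := by
            simp [Finset.card_disjSum, Finset.card_sigma]
        _ ≤ _ := by
            refine Finset.card_le_card fun y hy => ?_
            simp only [Finset.mem_filter, Finset.mem_univ, true_and]
            rcases y with z | z
            · simp only [Finset.inl_mem_disjSum, Finset.mem_sigma, Finset.mem_univ, and_true, J, I,
                Finset.mem_filter, true_and, Finset.mem_image] at hy
              obtain ⟨i, ⟨x, hx, rfl⟩, hi⟩ := hy
              exact ⟨x, hx, hi⟩
            · exact ⟨t0, ht0, trivial⟩
    refine h1.trans (le_trans ?_ h2)
    have h3 := hall I J (by simp [J])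
    have h4 : ((∑ i ∈ I, a i : ℕ) : ℝ) ≤ ((∑ j ∈ J, b j + D : ℕ) : ℝ) := by
      push_cast
      calc ∑ i ∈ I, (a i : ℝ) ≤ ∑ i ∈ I, N * p i := Finset.sum_le_sum fun i _ => ha i
        _ = N * ∑ i ∈ I, p i := by rw [Finset.mul_sum]
        _ ≤ N * (∑ j ∈ J, q j + η) := by gcongr
        _ = ∑ j ∈ J, N * q j + N * η := by rw [mul_add, Finset.mul_sum]
        _ ≤ ∑ j ∈ J, ((b j : ℝ) + 1) + N * η := by
            gcongr with j; linarith [hb' j]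
        _ = ∑ j ∈ J, (b j : ℝ) + J.card + N * η := by simp [Finset.sum_add_distrib]
        _ ≤ ∑ j ∈ J, (b j : ℝ) + Fintype.card ι + N * η := by
            gcongr; exact Finset.card_le_univ J
        _ ≤ ∑ j ∈ J, (b j : ℝ) + D := by linarith
    exact_mod_cast h4)
  let g : α → Option ι := fun x => match f x with
    | Sum.inl z => some z.1
    | Sum.inr _ => none
  have hg1 : ∀ x j, g x = some j → ∃ c : Fin (b j), f x = Sum.inl ⟨j, c⟩ := by
    intro x j h
    simp only [g] at h
    rcases hx : f x with ⟨k, c⟩ | z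
    · rw [hx] at h
      simp only [Option.some.injEq] at h
      subst h
      exact ⟨c, rfl⟩
    · rw [hx] at h; simp at h
  have hg0 : ∀ x, g x = none → ∃ z, f x = Sum.inr z := by
    intro x h
    simp only [g] at h
    rcases hx : f x with z | z
    · rw [hx] at h; simp at h
    · exact ⟨z, rfl⟩
  let M : ι → ι → Finset α := fun i j => Finset.univ.filter fun x => x.1 = i ∧ g x = some j
  have hrow : ∀ i, ∑ j, (M i j).card = (Finset.univ.filter fun x : α => x.1 = i ∧ g x ≠ none).card := by
    intro i
    rw [← Finset.card_biUnion]
    · congr 1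
      ext x
      simp only [M, Finset.mem_biUnion, Finset.mem_univ, Finset.mem_filter, true_and, ne_eq,
        Option.ne_none_iff_exists', exists_and_left]
    · intro j _ k _ hjk
      refine Finset.disjoint_left.2 fun x hx hx' => hjk ?_
      simp only [M, Finset.mem_filter, Finset.mem_univ, true_and] at hx hx'
      have := hx.2.symm.trans hx'.2
      simpa using this
  have hcol : ∀ j, ∑ i, (M i j).card = (Finset.univ.filter fun x : α => g x = some j).card := by
    intro j
    rw [← Finset.card_biUnion]
    · congr 1
      ext x
      simp [M]
    · intro i _ k _ hjk
      refine Finset.disjoint_left.2 fun x hx hx' => hjk ?_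
      simp only [M, Finset.mem_filter, Finset.mem_univ, true_and] at hx hx'
      exact hx.1.symm.trans hx'.1
  have htot : ∑ i, ∑ j, (M i j).card = (Finset.univ.filter fun x : α => g x ≠ none).card := by
    simp_rw [hrow]
    rw [← Finset.card_biUnion]
    · congr 1
      ext x
      simp
    · intro i _ k _ hjk
      refine Finset.disjoint_left.2 fun x hx hx' => hjk ?_
      simp only [Finset.mem_filter, Finset.mem_univ, true_and] at hx hx'
      exact hx.1.symm.trans hx'.1
  refine ⟨fun i j => (M i j).card / N, fun i j => by positivity, ?_, ?_, ?_, ?_⟩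
  · intro i j h
    have h1 : (M i j).card ≠ 0 := fun h0 => h (by simp [h0])
    obtain ⟨x, hx⟩ := Finset.card_pos.1 (Nat.pos_of_ne_zero h1)
    simp only [M, Finset.mem_filter, Finset.mem_univ, true_and] at hx
    obtain ⟨rfl, hx2⟩ := hx
    obtain ⟨c, hc⟩ := hg1 x j hx2
    have := hfr x
    rw [hc] at this
    exact this
  · intro i
    rw [← Finset.sum_div, div_le_iff₀ hN', ← Nat.cast_sum, hrow]
    have : (Finset.univ.filter fun x : α => x.1 = i ∧ g x ≠ none).card ≤ a i := by
      calc _ ≤ (({i} : Finset ι).sigma fun i => (Finset.univ : Finset (Fin (a i)))).card := by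
            refine Finset.card_le_card fun x hx => ?_
            simp only [Finset.mem_filter, Finset.mem_univ, true_and] at hx
            exact Finset.mem_sigma.2 ⟨Finset.mem_singleton.2 hx.1, Finset.mem_univ _⟩
        _ = a i := by simp [Finset.card_sigma]
    calc _ ≤ (a i : ℝ) := by exact_mod_cast this
      _ ≤ p i * N := by rw [mul_comm]; exact ha i
  · intro j
    rw [← Finset.sum_div, div_le_iff₀ hN', ← Nat.cast_sum, hcol]
    have : (Finset.univ.filter fun x : α => g x = some j).card ≤ b j := by
      calc _ ≤ ((({j} : Finset ι).sigma fun i => (Finset.univ : Finset (Fin (b i)))).disjSum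
              (∅ : Finset (Fin D))).card := by
            refine Finset.card_le_card_of_injOn f (fun x hx => ?_) hfinj.injOn
            simp only [Finset.coe_filter, Finset.mem_univ, true_and, mem_ofPred_eq] at hx
            obtain ⟨c, hc⟩ := hg1 x j hx
            rw [hc]
            simp
        _ = b j := by simp [Finset.card_sigma]
    calc _ ≤ (b j : ℝ) := by exact_mod_cast this
      _ ≤ q j * N := by rw [mul_comm]; exact hb j
  · have h0 : (Finset.univ.filter fun x : α => g x = none).card ≤ D := by
      calc _ ≤ ((∅ : Finset (Σ i, Fin (b i))).disjSum (Finset.univ : Finset (Fin D))).card := by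
            refine Finset.card_le_card_of_injOn f (fun x hx => ?_) hfinj.injOn
            simp only [Finset.coe_filter, Finset.mem_univ, true_and, mem_ofPred_eq] at hx
            obtain ⟨c, hc⟩ := hg0 x hx
            rw [hc]
            simp
        _ = D := by simp
    have h1 : (Finset.univ.filter fun x : α => g x = none).card +
        (Finset.univ.filter fun x : α => g x ≠ none).card = ∑ i, a i := by
      rw [Finset.card_filter_add_card_filter_not]
      simp [α]
    have h2 : (∑ i, (a i : ℝ)) ≤ D + ∑ i, ∑ j, ((M i j).card : ℝ) := by
      have : ∑ i, a i ≤ D + ∑ i, ∑ j, (M i j).card := by rw [htot]; omega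
      exact_mod_cast this
    have h3 : N * ∑ i, p i - Fintype.card ι ≤ ∑ i, (a i : ℝ) := by
      calc N * ∑ i, p i - Fintype.card ι = ∑ i, (N * p i - 1) := by
            rw [Finset.sum_sub_distrib, Finset.mul_sum]; simp
        _ ≤ _ := Finset.sum_le_sum fun i _ => ha' i
    simp_rw [← Finset.sum_div]
    rw [le_div_iff₀ hN', sub_mul, sub_mul, div_mul_cancel₀ _ hN'.ne']
    linarith

section CouplingPart
variable {S : Type*} [MeasurableSpace S]

lemma complete_coupling (P Q : Measure S) [IsProbabilityMeasure P] [IsProbabilityMeasure Q]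
    (π₀ : Measure (S × S)) (h1 : π₀.map Prod.fst ≤ P) (h2 : π₀.map Prod.snd ≤ Q) :
    ∃ π : Measure (S × S), π.map Prod.fst = P ∧ π.map Prod.snd = Q ∧
      ∀ E, π E ≤ π₀ E + (1 - π₀ univ) := by
  have hu1 : π₀.map Prod.fst univ = π₀ univ := by
    rw [Measure.map_apply measurable_fst MeasurableSet.univ, preimage_univ]
  have hu2 : π₀.map Prod.snd univ = π₀ univ := by
    rw [Measure.map_apply measurable_snd MeasurableSet.univ, preimage_univ]
  have hle : π₀ univ ≤ 1 := by
    rw [← hu1, ← measure_univ (μ := P)]; exact h1 univ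
  have : IsFiniteMeasure π₀ := ⟨hle.trans_lt ENNReal.one_lt_top⟩
  set P' := P - π₀.map Prod.fst with hP'
  set Q' := Q - π₀.map Prod.snd with hQ'
  have hPadd : P' + π₀.map Prod.fst = P := Measure.sub_add_cancel_of_le h1
  have hQadd : Q' + π₀.map Prod.snd = Q := Measure.sub_add_cancel_of_le h2
  set t := 1 - π₀ univ with ht
  have hPu : P' univ = t := by
    rw [hP', Measure.sub_apply MeasurableSet.univ h1, hu1, measure_univ]
  have hQu : Q' univ = t := by
    rw [hQ', Measure.sub_apply MeasurableSet.univ h2, hu2, measure_univ]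
  have htt : t ≠ ∞ := by rw [ht]; exact ENNReal.sub_ne_top ENNReal.one_ne_top
  have hPf : IsFiniteMeasure P' := ⟨by rw [hPu]; exact htt.lt_top⟩
  have hQf : IsFiniteMeasure Q' := ⟨by rw [hQu]; exact htt.lt_top⟩
  by_cases ht0 : t = 0
  · rw [ht0, Measure.measure_univ_eq_zero] at hPu hQu
    rw [hPu, zero_add] at hPadd
    rw [hQu, zero_add] at hQadd
    exact ⟨π₀, hPadd, hQadd, fun E => le_self_add⟩
  · refine ⟨π₀ + t⁻¹ • P'.prod Q', ?_, ?_, ?_⟩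
    · rw [Measure.map_add _ _ measurable_fst, Measure.map_smul, Measure.map_fst_prod, hQu, smul_smul,
        ENNReal.inv_mul_cancel ht0 htt, one_smul, add_comm, hPadd]
    · rw [Measure.map_add _ _ measurable_snd, Measure.map_smul, Measure.map_snd_prod, hPu, smul_smul,
        ENNReal.inv_mul_cancel ht0 htt, one_smul, add_comm, hQadd]
    · intro E
      rw [Measure.add_apply, Measure.smul_apply, smul_eq_mul]
      gcongr
      calc t⁻¹ * (P'.prod Q') E ≤ t⁻¹ * (P'.prod Q') univ := by gcongr; exact subset_univ _
        _ = t⁻¹ * (t * t) := by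
            rw [← univ_prod_univ, Measure.prod_prod, hPu, hQu]
        _ = t := by rw [← mul_assoc, ENNReal.inv_mul_cancel ht0 htt, one_mul]

/-- the sub-coupling associated with a transport matrix -/
lemma marg_le {ι : Type*} [Fintype ι] (P : Measure S) [IsProbabilityMeasure P]
    (A : ι → Set S) (hA : ∀ i, MeasurableSet (A i)) (hd : Pairwise fun i j => Disjoint (A i) (A j))
    (w : ι → ℝ≥0∞) (hw : ∀ i, P (A i) ≠ 0 → w i ≤ 1) :
    ∑ i, w i • P.restrict (A i) ≤ P := by
  refine Measure.le_iff.2 fun B hB => ?_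
  rw [Measure.finsetSum_apply]
  calc ∑ i, (w i • P.restrict (A i)) B ≤ ∑ i, P (B ∩ A i) := by
        refine Finset.sum_le_sum fun i _ => ?_
        rw [Measure.smul_apply, smul_eq_mul, Measure.restrict_apply hB]
        by_cases h : P (A i) = 0
        · rw [measure_mono_null inter_subset_right h]; simp
        · exact mul_le_of_le_one_left zero_le (hw i h)
    _ = P (⋃ i, B ∩ A i) := by
        rw [measure_iUnion, tsum_fintype]
        · exact fun i j hij => (hd hij).mono inter_subset_right inter_subset_right
        · exact fun i => hB.inter (hA i)
    _ ≤ P B := measure_mono (iUnion_subset fun i => inter_subset_left)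

lemma exists_subcoupling {ι : Type*} [Fintype ι] (P Q : Measure S) [IsProbabilityMeasure P]
    [IsProbabilityMeasure Q]
    (A : ι → Set S) (hA : ∀ i, MeasurableSet (A i)) (hd : Pairwise fun i j => Disjoint (A i) (A j))
    (m : ι → ι → ℝ) (hm : ∀ i j, 0 ≤ m i j) (hr : ∀ i, ∑ j, m i j ≤ P.real (A i))
    (hc : ∀ j, ∑ i, m i j ≤ Q.real (A j)) :
    ∃ π₀ : Measure (S × S), π₀.map Prod.fst ≤ P ∧ π₀.map Prod.snd ≤ Q ∧
      π₀ univ = ENNReal.ofReal (∑ i, ∑ j, m i j) ∧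
      ∀ E, MeasurableSet E → (∀ i j, m i j ≠ 0 → Disjoint E (A i ×ˢ A j)) → π₀ E = 0 := by
  have hmP : ∀ i j, P (A i) = 0 → m i j = 0 := by
    intro i j h
    have h1 := hr i
    rw [measureReal_def, h, ENNReal.toReal_zero] at h1
    have h2 : m i j ≤ ∑ j, m i j := Finset.single_le_sum (fun j _ => hm i j) (Finset.mem_univ j)
    exact le_antisymm (h2.trans h1) (hm i j)
  have hmQ : ∀ i j, Q (A j) = 0 → m i j = 0 := by
    intro i j h
    have h1 := hc j
    rw [measureReal_def, h, ENNReal.toReal_zero] at h1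
    have h2 : m i j ≤ ∑ i, m i j :=
      Finset.single_le_sum (f := fun i => m i j) (fun i _ => hm i j) (Finset.mem_univ i)
    exact le_antisymm (h2.trans h1) (hm i j)
  let c : ι → ι → ℝ≥0∞ := fun i j => ENNReal.ofReal (m i j) / (P (A i) * Q (A j))
  have hcQ : ∀ i j, c i j * Q (A j) = ENNReal.ofReal (m i j) / P (A i) := by
    intro i j
    by_cases h : Q (A j) = 0
    · simp [c, hmQ i j h]
    by_cases h' : P (A i) = 0
    · simp [c, hmP i j h']
    simp only [c]
    rw [div_eq_mul_inv, ENNReal.mul_inv (Or.inl h') (Or.inr h), mul_assoc, mul_assoc,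
      ENNReal.inv_mul_cancel h (measure_ne_top _ _), mul_one, div_eq_mul_inv]
  have hcP : ∀ i j, c i j * P (A i) = ENNReal.ofReal (m i j) / Q (A j) := by
    intro i j
    by_cases h : Q (A j) = 0
    · simp [c, hmQ i j h]
    by_cases h' : P (A i) = 0
    · simp [c, hmP i j h']
    simp only [c]
    rw [div_eq_mul_inv, mul_comm (P (A i)), ENNReal.mul_inv (Or.inl h) (Or.inr h'), mul_assoc, mul_assoc,
      ENNReal.inv_mul_cancel h' (measure_ne_top _ _), mul_one, div_eq_mul_inv]
  let π₀ : Measure (S × S) := ∑ i, ∑ j, c i j • (P.restrict (A i)).prod (Q.restrict (A j))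
  have hfst : π₀.map Prod.fst = ∑ i, (∑ j, c i j * Q (A j)) • P.restrict (A i) := by
    simp only [π₀]
    rw [← Measure.mapₗ_apply_of_measurable measurable_fst]
    simp only [map_sum, map_smul]
    simp only [Measure.mapₗ_apply_of_measurable measurable_fst, Measure.map_fst_prod,
      Measure.restrict_apply_univ, smul_smul, Finset.sum_smul]
  have hsnd : π₀.map Prod.snd = ∑ j, (∑ i, c i j * P (A i)) • Q.restrict (A j) := by
    simp only [π₀]
    rw [← Measure.mapₗ_apply_of_measurable measurable_snd, Finset.sum_comm]
    simp only [map_sum, map_smul]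
    simp only [Measure.mapₗ_apply_of_measurable measurable_snd, Measure.map_snd_prod,
      Measure.restrict_apply_univ, smul_smul, Finset.sum_smul]
  refine ⟨π₀, ?_, ?_, ?_, ?_⟩
  · rw [hfst]
    refine marg_le P A hA hd _ fun i h => ?_
    simp_rw [hcQ, div_eq_mul_inv]
    rw [← Finset.sum_mul, ← div_eq_mul_inv, ← ENNReal.ofReal_sum_of_nonneg fun j _ => hm i j]
    refine ENNReal.div_le_of_le_mul ?_
    rw [one_mul, ← ofReal_measureReal]
    exact ENNReal.ofReal_le_ofReal (hr i)
  · rw [hsnd]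
    refine marg_le Q A hA hd _ fun i h => ?_
    simp_rw [hcP, div_eq_mul_inv]
    rw [← Finset.sum_mul, ← div_eq_mul_inv, ← ENNReal.ofReal_sum_of_nonneg fun j _ => hm j i]
    refine ENNReal.div_le_of_le_mul ?_
    rw [one_mul, ← ofReal_measureReal]
    exact ENNReal.ofReal_le_ofReal (hc i)
  · simp only [π₀, Measure.finsetSum_apply, Measure.smul_apply, smul_eq_mul]
    rw [ENNReal.ofReal_sum_of_nonneg fun i _ => Finset.sum_nonneg fun j _ => hm i j]
    refine Finset.sum_congr rfl fun i _ => ?_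
    rw [ENNReal.ofReal_sum_of_nonneg fun j _ => hm i j]
    refine Finset.sum_congr rfl fun j _ => ?_
    rw [← univ_prod_univ, Measure.prod_prod, Measure.restrict_apply_univ,
      Measure.restrict_apply_univ, mul_comm (P (A i)), ← mul_assoc, hcQ]
    by_cases h' : P (A i) = 0
    · simp [hmP i j h']
    · exact ENNReal.div_mul_cancel h' (measure_ne_top _ _)
  · intro E hE h
    simp only [π₀, Measure.finsetSum_apply, Measure.smul_apply, smul_eq_mul]
    refine Finset.sum_eq_zero fun i _ => Finset.sum_eq_zero fun j _ => ?_
    by_cases h0 : m i j = 0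
    · simp [c, h0]
    · rw [Measure.prod_restrict, Measure.restrict_apply hE, (h i j h0).inter_eq]
      simp

end CouplingPart

lemma exists_coupling {S : Type*} [MeasurableSpace S] [MetricSpace S]
    [BorelSpace S] [TopologicalSpace.SeparableSpace S]
    (P Q : Measure S) [IsProbabilityMeasure P] [IsProbabilityMeasure Q] (ε δ : ℝ) (hε : 0 < ε)
    (hδ : 0 < δ) (hLP : levyProkhorovEDist P Q < ENNReal.ofReal ε) :
    ∃ π : Measure (S × S), π.map Prod.fst = P ∧ π.map Prod.snd = Q ∧
      π {z | ε + 3 * δ ≤ dist z.1 z.2} ≤ ENNReal.ofReal (ε + 3 * δ) := by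
  have := UniformSpace.secondCountable_of_separable S
  obtain ⟨A, hAm, hAb, hAd, hAu, hAdis⟩ :=
    MeasureTheory.SeparableSpace.exists_measurable_partition_diam_le S hδ
  have htail : ∀ μ : Measure S, IsProbabilityMeasure μ →
      ∀ᶠ n : ℕ in atTop, μ.real (⋃ i : Fin n, A i)ᶜ ≤ δ := by
    intro μ hμ
    have hmono : Monotone fun n : ℕ => ⋃ i : Fin n, A i := by
      intro n k hnk
      refine iUnion_subset fun i => ?_
      exact subset_iUnion (fun i : Fin k => A i) (Fin.castLE hnk i)
    have hun : ⋃ n : ℕ, ⋃ i : Fin n, A i = univ := by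
      refine eq_univ_of_forall fun x => ?_
      obtain ⟨i, hi⟩ := mem_iUnion.1 (hAu ▸ mem_univ x : x ∈ ⋃ n, A n)
      exact mem_iUnion.2 ⟨i + 1, mem_iUnion.2 ⟨Fin.last i, hi⟩⟩
    have hlim : Tendsto (fun n : ℕ => μ.real (⋃ i : Fin n, A i)) atTop (𝓝 (μ.real univ)) := by
      rw [← hun]
      exact (ENNReal.tendsto_toReal (measure_ne_top _ _)).comp (tendsto_measure_iUnion_atTop hmono)
    rw [probReal_univ] at hlim
    filter_upwards [hlim.eventually (lt_mem_nhds (show (1 : ℝ) - δ < 1 by linarith))] with n hn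
    rw [probReal_compl_eq_one_sub (MeasurableSet.iUnion fun i => hAm _)]
    linarith
  obtain ⟨n, hnP, hnQ⟩ := ((htail P inferInstance).and (htail Q inferInstance)).exists
  let B : Fin n → Set S := fun i => A i
  have hBm : ∀ i, MeasurableSet (B i) := fun i => hAm _
  have hBd : Pairwise fun i j => Disjoint (B i) (B j) := fun i j hij =>
    hAdis (fun h => hij (Fin.ext h))
  have hsum : ∀ μ : Measure S, IsProbabilityMeasure μ → ∀ I : Finset (Fin n),
      ∑ i ∈ I, μ.real (B i) = μ.real (⋃ i ∈ I, B i) := by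
    intro μ hμ I
    rw [measureReal_biUnion_finset]
    · exact fun i _ j _ hij => hBd hij
    · exact fun i _ => hBm i
  let R : Fin n → Fin n → Prop := fun i j => ∃ x ∈ B i, ∃ y ∈ B j, dist x y < ε
  obtain ⟨N, hN⟩ := exists_nat_gt ((2 * Fintype.card (Fin n) + 1) / δ)
  have hN0 : (0 : ℝ) < N := lt_of_le_of_lt (by positivity) hN
  obtain ⟨m, hm0, hmR, hmr, hmc, hmt⟩ := transport (fun i => P.real (B i)) (fun i => Q.real (B i))
    (fun i => measureReal_nonneg) (fun i => measureReal_nonneg) R (ε + δ) (by linarith) (by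
      intro I J hJ
      rw [hsum P inferInstance, hsum Q inferInstance]
      have h1 := left_measure_le_of_levyProkhorovEDist_lt hLP (B := ⋃ i ∈ I, B i)
        (Finset.measurableSet_biUnion _ fun i _ => hBm i)
      rw [ENNReal.toReal_ofReal hε.le] at h1
      have h2 : P.real (⋃ i ∈ I, B i) ≤ Q.real (Metric.thickening ε (⋃ i ∈ I, B i)) + ε := by
        have := ENNReal.toReal_mono (by finiteness) h1
        rw [ENNReal.toReal_add (by finiteness) (by finiteness), ENNReal.toReal_ofReal hε.le] at this
        exact this
      have h3 : Metric.thickening ε (⋃ i ∈ I, B i) ⊆ (⋃ j ∈ J, B j) ∪ (⋃ i : Fin n, A i)ᶜ := by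
        intro y hy
        obtain ⟨x, hx, hxy⟩ := Metric.mem_thickening_iff.1 hy
        simp only [mem_iUnion] at hx
        obtain ⟨i, hi, hx⟩ := hx
        by_cases hyA : y ∈ ⋃ i : Fin n, A i
        · left
          obtain ⟨j, hj⟩ := mem_iUnion.1 hyA
          simp only [mem_iUnion]
          exact ⟨j, (hJ j).2 ⟨i, hi, x, hx, y, hj, by rwa [dist_comm]⟩, hj⟩
        · right; exact hyA
      have h4 := (measureReal_mono (μ := Q) h3).trans (measureReal_union_le _ _)
      linarith) N (by exact_mod_cast hN0)
  obtain ⟨π₀, hf, hs, hu, hE⟩ := exists_subcoupling P Q B hBm hBd m hm0 hmr hmc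
  obtain ⟨π, hπf, hπs, hπ⟩ := complete_coupling P Q π₀ hf hs
  refine ⟨π, hπf, hπs, (hπ _).trans ?_⟩
  rw [hE _ (measurableSet_le measurable_const measurable_dist) ?_, zero_add, hu]
  · rw [← ENNReal.ofReal_one, ← ENNReal.ofReal_sub _
      (Finset.sum_nonneg fun i _ => Finset.sum_nonneg fun j _ => hm0 i j)]
    refine ENNReal.ofReal_le_ofReal ?_
    have h1 : ∑ i, P.real (B i) = P.real (⋃ i : Fin n, A i) := by
      rw [hsum P inferInstance]; simp [B]
    rw [probReal_compl_eq_one_sub (MeasurableSet.iUnion fun i => hAm _)] at hnP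
    have h2 : ((2 * Fintype.card (Fin n) + 1) / N : ℝ) ≤ δ := by
      rw [div_le_iff₀ hN0]
      rw [div_lt_iff₀ hδ] at hN
      linarith
    rw [h1] at hmt
    linarith
  · intro i j hij
    obtain ⟨x, hx, y, hy, hxy⟩ := hmR i j hij
    refine disjoint_left.2 ?_
    rintro ⟨x', y'⟩ (h : ε + 3 * δ ≤ dist x' y') ⟨hx', hy'⟩
    have h1 : dist x' x ≤ δ := (Metric.dist_le_diam_of_mem (hAb _) hx' hx).trans (hAd _)
    have h2 : dist y y' ≤ δ := (Metric.dist_le_diam_of_mem (hAb _) hy hy').trans (hAd _)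
    have h3 := dist_triangle4 x' x y y'
    linarith

lemma kyFan_bddBelow {Ω S : Type*} [MeasurableSpace Ω] [PseudoMetricSpace S]
    (P : Measure Ω) (X Y : Ω → S) :
    BddBelow {ε : ℝ | 0 < ε ∧ (P {ω | ε ≤ dist (X ω) (Y ω)}).toReal ≤ ε} :=
  ⟨0, fun _ h => h.1.le⟩

lemma measure_le_thickening_of_kyFan {Ω S : Type*} [MeasurableSpace Ω] [MeasurableSpace S]
    [MetricSpace S] [BorelSpace S] (μ : Measure Ω) [IsProbabilityMeasure μ] (X Y : Ω → S)
    (hX : Measurable X) (hY : Measurable Y) (r : ℝ) (e : ℝ≥0∞) (he : e ≠ ∞)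
    (hre : r ≤ e.toReal) (h : μ {ω | r ≤ dist (X ω) (Y ω)} ≤ e) (B : Set S)
    (hB : MeasurableSet B) :
    μ.map X B ≤ μ.map Y (Metric.thickening e.toReal B) + e := by
  rw [Measure.map_apply hX hB, Measure.map_apply hY Metric.isOpen_thickening.measurableSet]
  calc μ (X ⁻¹' B) ≤ μ (Y ⁻¹' Metric.thickening e.toReal B ∪ {ω | r ≤ dist (X ω) (Y ω)}) := by
        refine measure_mono fun ω hω => ?_
        by_cases hd : r ≤ dist (X ω) (Y ω)
        · right; exact hd
        · left
          push Not at hd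
          exact Metric.mem_thickening_iff.2 ⟨X ω, hω, by rw [dist_comm]; linarith⟩
    _ ≤ _ := (measure_union_le _ _).trans (by gcongr)

lemma lp_le_kyFan {Ω S : Type*} [MeasurableSpace Ω] [MeasurableSpace S]
    [MetricSpace S] [BorelSpace S] (μ : Measure Ω) [IsProbabilityMeasure μ] (X Y : Ω → S)
    (hX : Measurable X) (hY : Measurable Y) :
    levyProkhorovDist (μ.map X) (μ.map Y) ≤ kyFanDist μ X Y := by
  refine le_csInf ⟨1, one_pos, ?_⟩ ?_
  · exact measureReal_le_one
  · rintro r ⟨hr, hle⟩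
    refine ENNReal.toReal_le_of_le_ofReal hr.le (levyProkhorovEDist_le_of_forall _ _ _ ?_)
    intro e B hre he hB
    have hre' : r ≤ e.toReal := (ENNReal.ofReal_le_iff_le_toReal he.ne).1 hre.le
    have hm : μ {ω | r ≤ dist (X ω) (Y ω)} ≤ e := by
      refine le_trans ?_ hre.le
      rw [← ENNReal.ofReal_toReal (measure_ne_top μ {ω | r ≤ dist (X ω) (Y ω)})]
      exact ENNReal.ofReal_le_ofReal hle
    refine ⟨measure_le_thickening_of_kyFan μ X Y hX hY r e he.ne hre' hm B hB,
      measure_le_thickening_of_kyFan μ Y X hY hX r e he.ne hre' ?_ B hB⟩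
    simpa only [dist_comm] using hm

/-- The Lévy–Prokhorov distance between `P` and `Q` equals the infimum of the Ky Fan
distances `ρ(X,Y)` over random variables `X`, `Y` on a fixed nonatomic probability space
with `law X = P` and `law Y = Q`. -/
theorem stmt2 {Ω S : Type*} [MeasurableSpace Ω] [MeasurableSpace S] [MetricSpace S]
    [BorelSpace S] [CompleteSpace S] [TopologicalSpace.SeparableSpace S]
    (μΩ : Measure Ω) [IsProbabilityMeasure μΩ] (hna : Nonatomic μΩ)
    (P Q : Measure S) [IsProbabilityMeasure P] [IsProbabilityMeasure Q] :
    levyProkhorovDist P Q =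
      sInf {r : ℝ | ∃ X Y : Ω → S, Measurable X ∧ Measurable Y ∧
        μΩ.map X = P ∧ μΩ.map Y = Q ∧ r = kyFanDist μΩ X Y} := by

  have := UniformSpace.secondCountable_of_separable S
  have hne : Nonempty S := nonempty_of_isProbabilityMeasure P
  set T := {r : ℝ | ∃ X Y : Ω → S, Measurable X ∧ Measurable Y ∧
        μΩ.map X = P ∧ μΩ.map Y = Q ∧ r = kyFanDist μΩ X Y} with hT
  have hlow : ∀ r ∈ T, levyProkhorovDist P Q ≤ r := by
    rintro r ⟨X, Y, hX, hY, rfl, rfl, rfl⟩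
    exact lp_le_kyFan μΩ X Y hX hY
  have hbdd : BddBelow T := ⟨_, hlow⟩
  have hup : ∀ δ : ℝ, 0 < δ → ∃ r ∈ T, r ≤ levyProkhorovDist P Q + 4 * δ := by
    intro δ hδ
    have hnn : 0 ≤ levyProkhorovDist P Q := ENNReal.toReal_nonneg
    obtain ⟨π, hπ1, hπ2, hπ⟩ := exists_coupling P Q (levyProkhorovDist P Q + δ) δ (by linarith) hδ
      (by
        rw [ENNReal.lt_ofReal_iff_toReal_lt (levyProkhorovEDist_ne_top P Q)]
        change levyProkhorovDist P Q < _
        linarith)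
    have hprob : IsProbabilityMeasure π := ⟨by
      rw [← preimage_univ (f := Prod.fst), ← Measure.map_apply measurable_fst MeasurableSet.univ, hπ1,
        measure_univ]⟩
    obtain ⟨Z, hZ, hZl⟩ := exists_rv_law μΩ hna π
    refine ⟨_, ⟨fun ω => (Z ω).1, fun ω => (Z ω).2, measurable_fst.comp hZ, measurable_snd.comp hZ,
      ?_, ?_, rfl⟩, ?_⟩
    · rw [← hπ1, ← hZl, Measure.map_map measurable_fst hZ]; rfl
    · rw [← hπ2, ← hZl, Measure.map_map measurable_snd hZ]; rfl
    · refine csInf_le (kyFan_bddBelow _ _ _) ⟨by linarith, ?_⟩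
      rw [← hZl, Measure.map_apply hZ (measurableSet_le measurable_const measurable_dist)] at hπ
      have h4 : levyProkhorovDist P Q + δ + 3 * δ = levyProkhorovDist P Q + 4 * δ := by ring
      rw [h4] at hπ
      exact ENNReal.toReal_le_of_le_ofReal (by linarith) hπ
  apply le_antisymm
  · obtain ⟨r, hr, -⟩ := hup 1 one_pos
    exact le_csInf ⟨r, hr⟩ hlow
  · refine le_of_forall_pos_le_add fun e he => ?_
    obtain ⟨r, hr, hle⟩ := hup (e / 4) (by linarith)
    have := csInf_le hbdd hr
    linarith
end

section
/- Let X and Y be S-valued random variables on a complete nonatomic probability space with q(law(X), law(Y)) < ε. Then there exists a random variable Y' with law(Y') = law(Y) and ρ(X,Y') < ε. -/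
open MeasureTheory Filter Topology Set
open scoped ENNReal NNReal

lemma na_halve {Ω : Type*} [MeasurableSpace Ω] (P : Measure Ω) [IsFiniteMeasure P]
    (hna : Nonatomic P) (A : Set Ω) (hA : MeasurableSet A) (hp : 0 < P A) (n : ℕ) :
    ∃ B ⊆ A, MeasurableSet B ∧ 0 < P B ∧ P B * 2 ^ n ≤ P A := by
  induction n with
  | zero => exact ⟨A, le_rfl, hA, hp, by simp⟩
  | succ n ih =>
    obtain ⟨B, hBA, hB, hpB, hle⟩ := ih
    obtain ⟨C, hCB, hC, hpC, hlt⟩ := hna B hB hpB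
    have hadd : P C + P (B \ C) = P B := by
      rw [← measure_union disjoint_sdiff_right (hB.diff hC), union_sdiff_cancel hCB]
    have hpD : 0 < P (B \ C) := by
      rw [pos_iff_ne_zero]
      intro h0
      rw [h0, add_zero] at hadd
      exact hlt.ne hadd
    rcases le_total (P C) (P (B \ C)) with h | h
    · refine ⟨C, hCB.trans hBA, hC, hpC, le_trans ?_ hle⟩
      calc P C * 2 ^ (n + 1) = (P C + P C) * 2 ^ n := by ring
        _ ≤ (P C + P (B \ C)) * 2 ^ n := by gcongr
        _ = P B * 2 ^ n := by rw [hadd]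
    · refine ⟨B \ C, sdiff_subset.trans hBA, hB.diff hC, hpD, le_trans ?_ hle⟩
      calc P (B \ C) * 2 ^ (n + 1) = (P (B \ C) + P (B \ C)) * 2 ^ n := by ring
        _ ≤ (P C + P (B \ C)) * 2 ^ n := by gcongr
        _ = P B * 2 ^ n := by rw [hadd]

lemma na_small {Ω : Type*} [MeasurableSpace Ω] (P : Measure Ω) [IsFiniteMeasure P]
    (hna : Nonatomic P) (A : Set Ω) (hA : MeasurableSet A) (hp : 0 < P A) (t : ℝ≥0∞)
    (ht : 0 < t) :
    ∃ B ⊆ A, MeasurableSet B ∧ 0 < P B ∧ P B ≤ t := by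
  obtain ⟨n, hn⟩ := ENNReal.exists_nat_mul_gt ht.ne' (measure_ne_top P A)
  obtain ⟨B, hBA, hB, hpB, hle⟩ := na_halve P hna A hA hp n
  refine ⟨B, hBA, hB, hpB, ?_⟩
  by_contra! hlt
  have h2 : (n : ℝ≥0∞) ≤ 2 ^ n := by exact_mod_cast (Nat.lt_two_pow_self (n := n)).le
  have : (n : ℝ≥0∞) * t ≤ P B * 2 ^ n := by
    rw [mul_comm]; gcongr
  exact absurd (this.trans hle) (not_le.mpr hn)

lemma na_greedy {Ω : Type*} [MeasurableSpace Ω] (P : Measure Ω) [IsFiniteMeasure P]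
    (A B : Set Ω) (t : ℝ≥0∞) (hB : P B ≤ t) :
    ∃ C, MeasurableSet C ∧ C ⊆ A \ B ∧ P B + P C ≤ t ∧
      ∀ C', MeasurableSet C' → C' ⊆ A \ B → P B + P C' ≤ t → P C' ≤ 2 * P C := by
  by_cases h0 : ∀ C', MeasurableSet C' → C' ⊆ A \ B → P B + P C' ≤ t → P C' = 0
  · exact ⟨∅, MeasurableSet.empty, empty_subset _, by simpa using hB,
      fun C' h1 h2 h3 => by simp [h0 C' h1 h2 h3]⟩
  · push Not at h0
    obtain ⟨C₀, h1, h2, h3, h4⟩ := h0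
    let T : Set ℝ≥0∞ := {x | ∃ C', MeasurableSet C' ∧ C' ⊆ A \ B ∧ P B + P C' ≤ t ∧ P C' = x}
    have hpos : sSup T ≠ 0 := by
      have : P C₀ ≤ sSup T := le_sSup ⟨C₀, h1, h2, h3, rfl⟩
      intro h
      rw [h] at this
      exact h4 (le_antisymm this bot_le)
    have hfin : sSup T ≠ ∞ := by
      have : sSup T ≤ P univ := by
        apply sSup_le
        rintro x ⟨C', _, _, _, rfl⟩
        exact measure_mono (subset_univ _)
      exact (this.trans_lt (measure_lt_top P _)).ne
    obtain ⟨x, ⟨C, hC1, hC2, hC3, rfl⟩, hlt⟩ := lt_sSup_iff.mp (ENNReal.half_lt_self hpos hfin)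
    refine ⟨C, hC1, hC2, hC3, fun C' h1 h2 h3 => ?_⟩
    have h5 : P C' ≤ sSup T := le_sSup ⟨C', h1, h2, h3, rfl⟩
    refine h5.trans ?_
    rw [mul_comm]
    exact (ENNReal.div_le_iff (by simp) (by simp)).mp hlt.le

lemma na_split {Ω : Type*} [MeasurableSpace Ω] (P : Measure Ω) [IsFiniteMeasure P]
    (hna : Nonatomic P) (A : Set Ω) (hA : MeasurableSet A) (t : ℝ≥0∞) (ht : t ≤ P A) :
    ∃ B ⊆ A, MeasurableSet B ∧ P B = t := by
  choose! G hG1 hG2 hG3 hG4 using fun B (hB : P B ≤ t) => na_greedy P A B t hB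
  let Bs : ℕ → Set Ω := fun n => Nat.rec ∅ (fun _ B => B ∪ G B) n
  have hs : ∀ n, Bs (n + 1) = Bs n ∪ G (Bs n) := fun n => rfl
  have hadd : ∀ n, P (Bs n) ≤ t → P (Bs (n + 1)) = P (Bs n) + P (G (Bs n)) := by
    intro n h
    rw [hs]
    exact measure_union (disjoint_sdiff_right.mono_right (hG2 _ h)) (hG1 _ h)
  have key : ∀ n, MeasurableSet (Bs n) ∧ Bs n ⊆ A ∧ P (Bs n) ≤ t := by
    intro n
    induction n with
    | zero => simp [Bs]
    | succ n ih =>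
      obtain ⟨i1, i2, i3⟩ := ih
      refine ⟨?_, ?_, ?_⟩
      · rw [hs]; exact i1.union (hG1 _ i3)
      · rw [hs]; exact union_subset i2 ((hG2 _ i3).trans sdiff_subset)
      · rw [hadd n i3]; exact hG3 _ i3
  have hmono : Monotone Bs := monotone_nat_of_le_succ fun n => by
    rw [hs]; exact subset_union_left
  have hUle : P (⋃ n, Bs n) ≤ t := by
    rw [hmono.measure_iUnion]
    exact iSup_le fun n => (key n).2.2
  have hUm : MeasurableSet (⋃ n, Bs n) := MeasurableSet.iUnion fun n => (key n).1
  refine ⟨⋃ n, Bs n, iUnion_subset fun n => (key n).2.1, hUm, le_antisymm hUle ?_⟩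
  by_contra! hlt
  have hd : 0 < P (A \ ⋃ n, Bs n) := by
    have := le_measure_sdiff (μ := P) (s₁ := A) (s₂ := ⋃ n, Bs n)
    exact (tsub_pos_of_lt (hlt.trans_le ht)).trans_le this
  obtain ⟨C, hCs, hC, hCp, hCle⟩ := na_small P hna _ (hA.diff hUm) hd (t - P (⋃ n, Bs n))
    (tsub_pos_of_lt hlt)
  have hCn : ∀ n, P C ≤ 2 * P (G (Bs n)) := by
    intro n
    refine hG4 _ (key n).2.2 C hC ?_ ?_
    · exact hCs.trans (sdiff_subset_sdiff_right (subset_iUnion Bs n))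
    · calc P (Bs n) + P C ≤ P (⋃ n, Bs n) + (t - P (⋃ n, Bs n)) := by
            gcongr; exact subset_iUnion Bs n
        _ = t := add_tsub_cancel_of_le hUle
  have hgrow : ∀ n : ℕ, n * P C ≤ 2 * P (Bs n) := by
    intro n
    induction n with
    | zero => simp
    | succ n ih =>
      rw [hadd n (key n).2.2]
      push_cast
      rw [add_mul, one_mul, mul_add]
      exact add_le_add ih (hCn n)
  have htf : t ≠ ∞ := (ht.trans_lt (measure_lt_top P A)).ne
  obtain ⟨n, hn⟩ := ENNReal.exists_nat_mul_gt hCp.ne' (ENNReal.mul_ne_top (by simp : (2 : ℝ≥0∞) ≠ ∞) htf)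
  have : (n : ℝ≥0∞) * P C ≤ 2 * t := (hgrow n).trans (by gcongr; exact (key n).2.2)
  exact absurd this (not_le.mpr hn)

/-- the first `n` bits, in reverse order -/
def bitInit (x : ℕ → Bool) : ℕ → List Bool
  | 0 => []
  | n + 1 => x n :: bitInit x n

lemma bitInit_length (x : ℕ → Bool) (n : ℕ) : (bitInit x n).length = n := by
  induction n with
  | zero => rfl
  | succ n ih => simp [bitInit, ih]

lemma bitInit_mono {x y : ℕ → Bool} {m n : ℕ} (hmn : m ≤ n)
    (h : bitInit x n = bitInit y n) : bitInit x m = bitInit y m := by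
  induction n, hmn using Nat.le_induction with
  | base => exact h
  | succ n _ ih =>
    simp only [bitInit, List.cons.injEq] at h
    exact ih h.2

/-- cylinder sets -/
def bitCyl (l : List Bool) : Set (ℕ → Bool) := {x | bitInit x l.length = l}

lemma bitCyl_nil : bitCyl [] = univ := by ext; simp [bitCyl, bitInit]

lemma bitCyl_cons (b : Bool) (l : List Bool) :
    bitCyl (b :: l) = bitCyl l ∩ {x | x l.length = b} := by
  ext x; simp [bitCyl, bitInit, and_comm]

lemma bitCyl_meas (l : List Bool) : MeasurableSet (bitCyl l) := by
  induction l with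
  | nil => rw [bitCyl_nil]; exact MeasurableSet.univ
  | cons b l ih =>
    rw [bitCyl_cons]
    have h : MeasurableSet ((fun f : ℕ → Bool => f l.length) ⁻¹' {b}) :=
      measurable_pi_apply l.length (measurableSet_singleton b)
    exact ih.inter h

lemma bitCyl_pi : IsPiSystem (range bitCyl) := by
  rintro _ ⟨l, rfl⟩ _ ⟨l', rfl⟩ ⟨x, hx, hx'⟩
  wlog h : l.length ≤ l'.length generalizing l l'
  · rw [inter_comm]; exact this l' l hx' hx (le_of_not_ge h)
  · refine ⟨l', (inter_eq_right.mpr ?_).symm⟩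
    intro y hy
    have h1 : bitInit y l'.length = bitInit x l'.length := by
      rw [show bitInit y l'.length = l' from hy, show bitInit x l'.length = l' from hx']
    exact (bitInit_mono h h1).trans hx

lemma bitCyl_gen : (MeasurableSpace.pi : MeasurableSpace (ℕ → Bool)) =
    MeasurableSpace.generateFrom (range bitCyl) := by
  apply le_antisymm
  · refine iSup_le fun n => ?_
    rw [← measurable_iff_comap_le]
    refine @measurable_to_bool _ (MeasurableSpace.generateFrom (range bitCyl)) _ ?_
    have : (fun x : ℕ → Bool => x n) ⁻¹' {true} =
        ⋃ l : {l : List Bool // l.length = n}, bitCyl (true :: l.1) := by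
      ext x
      simp only [mem_preimage, mem_singleton_iff, mem_iUnion, bitCyl_cons]
      constructor
      · intro h
        exact ⟨⟨bitInit x n, bitInit_length x n⟩,
          by simp [bitCyl, bitInit_length], by simpa [bitInit_length] using h⟩
      · rintro ⟨⟨l, rfl⟩, -, h⟩
        exact h
    rw [this]
    exact @MeasurableSet.iUnion _ _ (MeasurableSpace.generateFrom (range bitCyl)) _ _
      fun l => MeasurableSpace.measurableSet_generateFrom ⟨_, rfl⟩
  · apply MeasurableSpace.generateFrom_le
    rintro _ ⟨l, rfl⟩
    exact bitCyl_meas l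

/-- sets of the splitting tree -/
def treeSet {Ω : Type*} (A : Set Ω) (D : List Bool → Set Ω → Set Ω) : List Bool → Set Ω
  | [] => A
  | true :: l => treeSet A D l ∩ D l (treeSet A D l)
  | false :: l => treeSet A D l \ D l (treeSet A D l)

open Classical in
/-- the list of bits of a point in the splitting tree -/
noncomputable def treePath {Ω : Type*} (E : List Bool → Set Ω) (w : Ω) : ℕ → List Bool
  | 0 => []
  | n + 1 => decide (w ∈ E (treePath E w n)) :: treePath E w n

open Classical in
lemma na_law_bits {Ω : Type*} [MeasurableSpace Ω] (P : Measure Ω) [IsFiniteMeasure P]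
    (hna : Nonatomic P) (A : Set Ω) (hA : MeasurableSet A) (κ : Measure (ℕ → Bool))
    (hκ : κ univ = P A) :
    ∃ g : Ω → (ℕ → Bool), Measurable g ∧ (P.restrict A).map g = κ := by
  have : IsFiniteMeasure κ := ⟨by rw [hκ]; exact measure_lt_top P A⟩
  have hsplit : ∀ (l : List Bool) (B : Set Ω), ∃ D, (MeasurableSet B → P B = κ (bitCyl l) →
      D ⊆ B ∧ MeasurableSet D ∧ P D = κ (bitCyl (true :: l))) := by
    intro l B
    by_cases h : MeasurableSet B ∧ P B = κ (bitCyl l)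
    · obtain ⟨D, h1, h2, h3⟩ := na_split P hna B h.1 (κ (bitCyl (true :: l))) (by
        rw [h.2, bitCyl_cons]; exact measure_mono inter_subset_left)
      exact ⟨D, fun _ _ => ⟨h1, h2, h3⟩⟩
    · exact ⟨∅, fun h1 h2 => absurd ⟨h1, h2⟩ h⟩
  choose D hD using hsplit
  have hadd : ∀ l, κ (bitCyl (true :: l)) + κ (bitCyl (false :: l)) = κ (bitCyl l) := by
    intro l
    rw [← measure_union _ (bitCyl_meas _)]
    · congr 1
      ext x
      simp only [bitCyl_cons, mem_union, mem_inter_iff, mem_ofPred_eq]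
      cases x l.length <;> simp
    · rw [Set.disjoint_left]
      intro x hx hx'
      rw [bitCyl_cons] at hx hx'
      have h1 : x l.length = true := hx.2
      have h2 : x l.length = false := hx'.2
      simp [h1] at h2
  have key : ∀ l, MeasurableSet (treeSet A D l) ∧ P (treeSet A D l) = κ (bitCyl l) := by
    intro l
    induction l with
    | nil => exact ⟨hA, by rw [bitCyl_nil, hκ]; rfl⟩
    | cons b l ih =>
      obtain ⟨h1, h2, h3⟩ := hD l _ ih.1 ih.2
      cases b
      · refine ⟨ih.1.diff h2, ?_⟩
        change P (treeSet A D l \ D l (treeSet A D l)) = _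
        rw [measure_sdiff h1 h2.nullMeasurableSet (measure_ne_top _ _), h3, ih.2, ← hadd l]
        exact ENNReal.add_sub_cancel_left (measure_ne_top _ _)
      · refine ⟨ih.1.inter h2, ?_⟩
        change P (treeSet A D l ∩ D l (treeSet A D l)) = _
        rw [inter_eq_right.mpr h1, h3]
  let E : List Bool → Set Ω := fun l => D l (treeSet A D l)
  have hE : ∀ l, MeasurableSet (E l) := fun l => (hD l _ (key l).1 (key l).2).2.1
  let g : Ω → ℕ → Bool := fun w n => decide (w ∈ E (treePath E w n))
  have hpre : ∀ w n, bitInit (g w) n = treePath E w n := by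
    intro w n
    induction n with
    | zero => rfl
    | succ n ih => simp [bitInit, treePath, ih, g]
  have hcyl : ∀ l, A ∩ g ⁻¹' (bitCyl l) = treeSet A D l := by
    intro l
    induction l with
    | nil => simp [bitCyl_nil, treeSet]
    | cons b l ih =>
      have hb : ∀ w, w ∈ A ∩ g ⁻¹' (bitCyl (b :: l)) ↔
          w ∈ treeSet A D l ∧ decide (w ∈ E l) = b := by
        intro w
        rw [← ih, bitCyl_cons]
        have : ∀ _ : g w ∈ bitCyl l, g w l.length = decide (w ∈ E l) := by
          intro h
          have h' : bitInit (g w) l.length = l := h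
          rw [hpre] at h'
          simp only [g, h']
        constructor
        · rintro ⟨h1, h2, h3⟩
          exact ⟨⟨h1, h2⟩, (this h2).symm.trans h3⟩
        · rintro ⟨⟨h1, h2⟩, h3⟩
          exact ⟨h1, h2, (this h2).trans h3⟩
      ext w
      rw [hb]
      cases b <;> simp [treeSet, E]
  have hpm : ∀ n l, MeasurableSet {w | treePath E w n = l} := by
    intro n
    induction n with
    | zero => intro l; simp [treePath]
    | succ n ih =>
      intro l
      cases l with
      | nil => simp [treePath]
      | cons b l =>
        have : {w | treePath E w (n + 1) = b :: l} =
            {w | treePath E w n = l} ∩ (if b then E l else (E l)ᶜ) := by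
          ext w
          simp only [treePath, List.cons.injEq, mem_ofPred_eq, mem_inter_iff]
          constructor
          · rintro ⟨h1, h2⟩
            refine ⟨h2, ?_⟩
            rw [h2] at h1
            cases b <;> simpa using h1
          · rintro ⟨h1, h2⟩
            refine ⟨?_, h1⟩
            rw [h1]
            cases b <;> simpa using h2
        rw [this]
        refine (ih l).inter ?_
        split_ifs
        · exact hE l
        · exact (hE l).compl
  have hg : Measurable g := by
    refine measurable_pi_lambda _ fun n => measurable_to_bool ?_
    have : (fun w => g w n) ⁻¹' {true} = ⋃ l, ({w | treePath E w n = l} ∩ E l) := by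
      ext w; simp [g]
    rw [this]
    exact MeasurableSet.iUnion fun l => (hpm n l).inter (hE l)
  refine ⟨g, hg, ?_⟩
  have hall : ∀ l, (P.restrict A).map g (bitCyl l) = κ (bitCyl l) := by
    intro l
    rw [Measure.map_apply hg (bitCyl_meas l), Measure.restrict_apply (hg (bitCyl_meas l)),
      inter_comm, hcyl, (key l).2]
  refine ext_of_generate_finite (range bitCyl) bitCyl_gen bitCyl_pi ?_ ?_
  · rintro _ ⟨l, rfl⟩; exact hall l
  · rw [← bitCyl_nil]; exact hall []

lemma na_law {Ω S : Type*} [MeasurableSpace Ω] [MeasurableSpace S] [StandardBorelSpace S]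
    [Nonempty S] (P : Measure Ω) [IsFiniteMeasure P]
    (hna : Nonatomic P) (A : Set Ω) (hA : MeasurableSet A) (κ : Measure S)
    (hκ : κ univ = P A) :
    ∃ g : Ω → S, Measurable g ∧ (P.restrict A).map g = κ := by
  have he : MeasurableEmbedding (MeasurableSpace.mapNatBool S) :=
    (MeasurableSpace.measurable_mapNatBool S).measurableEmbedding
      (MeasurableSpace.injective_mapNatBool S)
  obtain ⟨g, hg, hgm⟩ := na_law_bits P hna A hA (κ.map (MeasurableSpace.mapNatBool S)) (by
    rw [Measure.map_apply he.measurable MeasurableSet.univ, preimage_univ, hκ])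
  refine ⟨he.invFun ∘ g, he.measurable_invFun.comp hg, ?_⟩
  rw [← Measure.map_map he.measurable_invFun hg, hgm,
    Measure.map_map he.measurable_invFun he.measurable]
  rw [he.leftInverse_invFun.comp_eq_id, Measure.map_id]

lemma na_glue {Ω S : Type*} [MeasurableSpace Ω] [MeasurableSpace S] [StandardBorelSpace S]
    [Nonempty S] (P : Measure Ω) [IsFiniteMeasure P]
    (hna : Nonatomic P) (Z : Ω → ℕ) (hZ : Measurable Z) (κ : ℕ → Measure S)
    (hκ : ∀ k, κ k univ = P (Z ⁻¹' {k})) :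
    ∃ g : Ω → S, Measurable g ∧ (∀ k (B : Set S), MeasurableSet B →
        P (Z ⁻¹' {k} ∩ g ⁻¹' B) = κ k B) := by
  choose g hg hgm using fun k => na_law P hna (Z ⁻¹' {k}) (hZ (measurableSet_singleton k)) (κ k)
    (hκ k)
  have hm : Measurable (fun w => g (Z w) w) := by
    have h : Measurable (fun p : ℕ × Ω => g p.1 p.2) :=
      measurable_from_prod_countable_right fun k => hg k
    exact h.comp (hZ.prodMk measurable_id)
  refine ⟨_, hm, fun k B hB => ?_⟩
  rw [← hgm k, Measure.map_apply (hg k) hB, Measure.restrict_apply (hg k hB), inter_comm]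
  congr 1
  ext w
  simp only [mem_inter_iff, mem_preimage, mem_singleton_iff]
  constructor
  · rintro ⟨h1, h2⟩; exact ⟨by rw [← h2]; exact h1, h2⟩
  · rintro ⟨h1, h2⟩; exact ⟨by rw [h2]; exact h1, h2⟩

open Classical in
lemma frac_hall (n : ℕ) (a b : Fin n → ℝ) (ha : ∀ i, 0 ≤ a i) (hb : ∀ i, 0 ≤ b i)
    (r : Fin n → Fin n → Prop) (θ : ℝ) (hθ : 0 ≤ θ)
    (h : ∀ I : Finset (Fin n), ∑ i ∈ I, a i ≤
      ∑ j ∈ Finset.univ.filter (fun j => ∃ i ∈ I, r i j), b j + θ)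
    (τ : ℝ) (hτ : 0 < τ) :
    ∃ m : Fin n → Fin n → ℝ, (∀ i j, 0 ≤ m i j) ∧ (∀ i j, m i j ≠ 0 → r i j) ∧
      (∀ i, ∑ j, m i j ≤ a i) ∧ (∀ j, ∑ i, m i j ≤ b j) ∧
      ∑ i, a i - θ - τ ≤ ∑ i, ∑ j, m i j := by
  obtain ⟨N, hN⟩ := exists_nat_gt ((2 * n + 1) / τ)
  have hN0 : (0 : ℝ) < N := lt_trans (by positivity) hN
  have hNτ : 2 * (n : ℝ) + 1 ≤ τ * N := by
    rw [div_lt_iff₀ hτ] at hN; linarith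
  let av : Fin n → ℕ := fun i => ⌊N * a i⌋₊
  let bv : Fin n → ℕ := fun i => ⌊N * b i⌋₊
  let K : ℕ := ⌈N * θ⌉₊ + n
  have hav : ∀ i, (av i : ℝ) ≤ N * a i := fun i => Nat.floor_le (mul_nonneg hN0.le (ha i))
  have hbv : ∀ i, (bv i : ℝ) ≤ N * b i := fun i => Nat.floor_le (mul_nonneg hN0.le (hb i))
  have hav' : ∀ i, N * a i ≤ (av i : ℝ) + 1 := fun i => (Nat.lt_floor_add_one _).le
  have hbv' : ∀ i, N * b i ≤ (bv i : ℝ) + 1 := fun i => (Nat.lt_floor_add_one _).le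
  have hK1 : N * θ + n ≤ (K : ℝ) := by
    simp only [K]; push_cast
    have := Nat.le_ceil (N * θ); linarith
  have hK2 : (K : ℝ) ≤ N * θ + n + 1 := by
    simp only [K]; push_cast
    have := Nat.ceil_lt_add_one (mul_nonneg hN0.le hθ); linarith
  let α := Σ i : Fin n, Fin (av i)
  let β := (Σ i : Fin n, Fin (bv i)) ⊕ Fin K
  let r' : α → β → Prop := fun x y => Sum.elim (fun z => r x.1 z.1) (fun _ => True) y
  have hall : ∀ A : Finset α, A.card ≤ (Finset.univ.filter (fun y : β => ∃ x ∈ A, r' x y)).card := by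
    intro A
    rcases A.eq_empty_or_nonempty with rfl | ⟨x₀, hx₀⟩
    · simp
    let I : Finset (Fin n) := A.image (fun x => x.1)
    let J : Finset (Fin n) := Finset.univ.filter (fun j => ∃ i ∈ I, r i j)
    have h1 : A.card ≤ ∑ i ∈ I, av i := by
      have : A ⊆ I.sigma (fun i => (Finset.univ : Finset (Fin (av i)))) := by
        intro x hx
        exact Finset.mem_sigma.mpr ⟨Finset.mem_image_of_mem _ hx, Finset.mem_univ _⟩
      refine (Finset.card_le_card this).trans (le_of_eq ?_)
      refine (Finset.card_sigma _ _).trans ?_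
      exact Finset.sum_congr rfl fun i _ => by rw [Finset.card_univ, Fintype.card_fin]
    have h2 : ∑ j ∈ J, bv j + K ≤ (Finset.univ.filter (fun y : β => ∃ x ∈ A, r' x y)).card := by
      have : (J.sigma (fun j => (Finset.univ : Finset (Fin (bv j))))).disjSum
          (Finset.univ : Finset (Fin K)) ⊆ Finset.univ.filter (fun y : β => ∃ x ∈ A, r' x y) := by
        intro y hy
        simp only [Finset.mem_filter, Finset.mem_univ, true_and]
        rcases y with y | y
        · simp only [Finset.inl_mem_disjSum, Finset.mem_sigma, Finset.mem_univ, and_true, J,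
            Finset.mem_filter, true_and, I, Finset.mem_image] at hy
          obtain ⟨i, ⟨x, hx, rfl⟩, hr⟩ := hy
          exact ⟨x, hx, hr⟩
        · exact ⟨x₀, hx₀, trivial⟩
      have := Finset.card_le_card this
      simpa [Finset.card_disjSum, Finset.card_sigma] using this
    refine le_trans ?_ h2
    refine h1.trans ?_
    have h3 : ((∑ i ∈ I, av i : ℕ) : ℝ) ≤ ((∑ j ∈ J, bv j + K : ℕ) : ℝ) := by
      push_cast
      calc ∑ i ∈ I, (av i : ℝ) ≤ ∑ i ∈ I, N * a i := Finset.sum_le_sum fun i _ => hav i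
        _ = N * ∑ i ∈ I, a i := by rw [Finset.mul_sum]
        _ ≤ N * (∑ j ∈ J, b j + θ) := by gcongr; exact h I
        _ = ∑ j ∈ J, N * b j + N * θ := by rw [mul_add, Finset.mul_sum]
        _ ≤ ∑ j ∈ J, ((bv j : ℝ) + 1) + N * θ := by gcongr with j _; exact hbv' j
        _ = ∑ j ∈ J, (bv j : ℝ) + J.card + N * θ := by simp [Finset.sum_add_distrib]
        _ ≤ ∑ j ∈ J, (bv j : ℝ) + K := by
          have : (J.card : ℝ) ≤ n := by
            exact_mod_cast (Finset.card_le_univ J).trans (by simp)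
          linarith
    exact_mod_cast h3
  obtain ⟨f, hfi, hfr⟩ := (Fintype.all_card_le_filter_rel_iff_exists_injective r').mp hall
  let p : α → Option (Fin n) := fun x => Sum.elim (fun z => some z.1) (fun _ => none) (f x)
  have hps : ∀ x j, p x = some j → ∃ z : Fin (bv j), f x = Sum.inl ⟨j, z⟩ := by
    intro x j hp
    simp only [p] at hp
    rcases hf : f x with y | y
    · rw [hf] at hp
      obtain ⟨j', z⟩ := y
      simp only [Sum.elim_inl, Option.some.injEq] at hp
      subst hp
      exact ⟨z, rfl⟩
    · rw [hf] at hp; simp at hp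
  have hpn : ∀ x, p x = none → ∃ z : Fin K, f x = Sum.inr z := by
    intro x hp
    simp only [p] at hp
    rcases hf : f x with y | y
    · rw [hf] at hp; simp at hp
    · exact ⟨y, rfl⟩
  let c : Fin n → Fin n → ℕ := fun i j =>
    (Finset.univ.filter (fun x : α => x.1 = i ∧ p x = some j)).card
  have hrow : ∀ i, ∑ j, c i j ≤ av i := by
    intro i
    have h1 := Finset.card_eq_sum_card_fiberwise (f := p)
      (s := Finset.univ.filter (fun x : α => x.1 = i)) (t := Finset.univ) (by simp [Set.MapsTo])
    rw [Fintype.sum_option] at h1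
    simp only [Finset.filter_filter] at h1
    have h2 : (Finset.univ.filter (fun x : α => x.1 = i)).card ≤ av i := by
      have : Finset.univ.filter (fun x : α => x.1 = i) ⊆
          (Finset.univ : Finset (Fin (av i))).image (fun z => (⟨i, z⟩ : α)) := by
        rintro ⟨i', z⟩ hx
        simp only [Finset.mem_filter, Finset.mem_univ, true_and] at hx
        subst hx
        simp
      exact (Finset.card_le_card this).trans (Finset.card_image_le.trans (by simp))
    simp only [c]
    omega
  have hcolEq : ∀ j, ∑ i, c i j = (Finset.univ.filter (fun x : α => p x = some j)).card := by
    intro j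
    have h1 := Finset.card_eq_sum_card_fiberwise (f := fun x : α => x.1)
      (s := Finset.univ.filter (fun x : α => p x = some j)) (t := Finset.univ)
      (by simp [Set.MapsTo])
    rw [h1]
    simp only [Finset.filter_filter, c, and_comm]
  have hcol : ∀ j, ∑ i, c i j ≤ bv j := by
    intro j
    rw [hcolEq]
    have : (Finset.univ.filter (fun x : α => p x = some j)).image f ⊆
        (Finset.univ : Finset (Fin (bv j))).image (fun z => (Sum.inl ⟨j, z⟩ : β)) := by
      intro y hy
      simp only [Finset.mem_image, Finset.mem_filter, Finset.mem_univ, true_and] at hy ⊢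
      obtain ⟨x, hx, rfl⟩ := hy
      obtain ⟨z, hz⟩ := hps x j hx
      exact ⟨z, hz.symm⟩
    have h1 := (Finset.card_le_card this).trans (Finset.card_image_le.trans (by simp; rfl))
    rwa [Finset.card_image_of_injective _ hfi] at h1
  have htot : ∑ i, av i ≤ ∑ i, ∑ j, c i j + K := by
    rw [Finset.sum_comm]
    simp only [hcolEq]
    have h1 := Finset.card_eq_sum_card_fiberwise (f := p)
      (s := (Finset.univ : Finset α)) (t := Finset.univ) (by simp [Set.MapsTo])
    rw [Fintype.sum_option] at h1
    have h2 : (Finset.univ : Finset α).card = ∑ i, av i := by simp [α]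
    have h3 : (Finset.univ.filter (fun x : α => p x = none)).card ≤ K := by
      have : (Finset.univ.filter (fun x : α => p x = none)).image f ⊆
          (Finset.univ : Finset (Fin K)).image (fun z => (Sum.inr z : β)) := by
        intro y hy
        simp only [Finset.mem_image, Finset.mem_filter, Finset.mem_univ, true_and] at hy ⊢
        obtain ⟨x, hx, rfl⟩ := hy
        obtain ⟨z, hz⟩ := hpn x hx
        exact ⟨z, hz.symm⟩
      have h1 := (Finset.card_le_card this).trans (Finset.card_image_le.trans (by simp; rfl))
      rwa [Finset.card_image_of_injective _ hfi] at h1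
    omega
  refine ⟨fun i j => (c i j : ℝ) / N, fun i j => by positivity, ?_, ?_, ?_, ?_⟩
  · intro i j hne
    have : c i j ≠ 0 := by
      intro h0; simp [h0] at hne
    obtain ⟨x, hx⟩ := Finset.card_pos.mp (Nat.pos_of_ne_zero this)
    simp only [Finset.mem_filter, Finset.mem_univ, true_and] at hx
    obtain ⟨rfl, hp⟩ := hx
    obtain ⟨z, hz⟩ := hps x j hp
    have := hfr x
    rw [hz] at this
    exact this
  · intro i
    rw [← Finset.sum_div, div_le_iff₀ hN0]
    have : ((∑ j, c i j : ℕ) : ℝ) ≤ av i := by exact_mod_cast hrow i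
    push_cast at this
    linarith [hav i]
  · intro j
    rw [← Finset.sum_div, div_le_iff₀ hN0]
    have : ((∑ i, c i j : ℕ) : ℝ) ≤ bv j := by exact_mod_cast hcol j
    push_cast at this
    linarith [hbv j]
  · simp only [← Finset.sum_div]
    rw [le_div_iff₀ hN0]
    have h1 : ((∑ i, av i : ℕ) : ℝ) ≤ ((∑ i, ∑ j, c i j + K : ℕ) : ℝ) := by exact_mod_cast htot
    push_cast at h1
    have h2 : N * ∑ i, a i ≤ ∑ i, (av i : ℝ) + n := by
      rw [Finset.mul_sum]
      calc ∑ i, N * a i ≤ ∑ i, ((av i : ℝ) + 1) := Finset.sum_le_sum fun i _ => hav' i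
        _ = ∑ i, (av i : ℝ) + n := by simp [Finset.sum_add_distrib]
    nlinarith

open Classical in
lemma frac_hall' (n : ℕ) (a b : ℕ → ℝ≥0∞) (ha : ∀ i, a i ≠ ∞) (hb : ∀ i, b i ≠ ∞)
    (r : ℕ → ℕ → Prop) (θ : ℝ) (hθ : 0 ≤ θ)
    (h : ∀ I : Finset ℕ, I ⊆ Finset.range n → ∑ i ∈ I, (a i).toReal ≤
      ∑ j ∈ (Finset.range n).filter (fun j => ∃ i ∈ I, r i j), (b j).toReal + θ)
    (τ : ℝ) (hτ : 0 < τ) :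
    ∃ M : ℕ → ℕ → ℝ≥0∞, (∀ i j, M i j ≠ 0 → r i j) ∧
      (∀ i, ∑' j, M i j ≤ a i) ∧ (∀ j, ∑' i, M i j ≤ b j) ∧
      ENNReal.ofReal (∑ i ∈ Finset.range n, (a i).toReal - θ - τ) ≤ ∑' i, ∑' j, M i j := by
  obtain ⟨m, h0, h1, h2, h3, h4⟩ := frac_hall n (fun i => (a i).toReal) (fun i => (b i).toReal)
    (fun i => ENNReal.toReal_nonneg) (fun i => ENNReal.toReal_nonneg) (fun i j => r i j) θ hθ
    (by
      intro I
      have := h (I.map Fin.valEmbedding) (by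
        intro x hx
        simp only [Finset.mem_map, Fin.valEmbedding_apply] at hx
        obtain ⟨i, -, rfl⟩ := hx
        simp)
      rw [Finset.sum_map] at this
      refine this.trans (le_of_eq ?_)
      congr 1
      symm
      refine Finset.sum_bij (fun j _ => (j : ℕ)) ?_ ?_ ?_ ?_
      · intro j hj
        simpa using hj
      · intro j _ j' _ hjj
        exact Fin.ext hjj
      · intro j hj
        simp only [Finset.mem_filter, Finset.mem_range, Finset.mem_map,
          Fin.valEmbedding_apply] at hj
        refine ⟨⟨j, hj.1⟩, ?_, rfl⟩
        simpa using hj.2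
      · intros; rfl) τ hτ
  let M : ℕ → ℕ → ℝ≥0∞ := fun i j =>
    if hh : i < n ∧ j < n then ENNReal.ofReal (m ⟨i, hh.1⟩ ⟨j, hh.2⟩) else 0
  have hM : ∀ i j : Fin n, M i j = ENNReal.ofReal (m i j) := by
    intro i j; simp [M]
  have hrow0 : ∀ i j, ¬ i < n → M i j = 0 := by intro i j hi; simp [M, hi]
  have hcol0 : ∀ i j, ¬ j < n → M i j = 0 := by intro i j hi; simp [M, hi]
  have hR : ∀ i, ∑' j, M i j = ∑ j : Fin n, M i j := by
    intro i
    rw [tsum_eq_sum (s := Finset.range n) (by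
      intro j hj; exact hcol0 i j (by simpa using hj)), Finset.sum_range]
  have hC : ∀ j, ∑' i, M i j = ∑ i : Fin n, M i j := by
    intro i
    rw [tsum_eq_sum (s := Finset.range n) (by
      intro j hj; exact hrow0 j i (by simpa using hj)), Finset.sum_range]
  refine ⟨M, ?_, ?_, ?_, ?_⟩
  · intro i j hne
    by_cases hh : i < n ∧ j < n
    · refine h1 ⟨i, hh.1⟩ ⟨j, hh.2⟩ ?_
      intro h0
      simp [M, h0] at hne
    · simp [M, hh] at hne
  · intro i
    by_cases hi : i < n
    · rw [hR]
      have := h2 ⟨i, hi⟩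
      rw [show ∑ j : Fin n, M i j = ENNReal.ofReal (∑ j, m ⟨i, hi⟩ j) by
        rw [ENNReal.ofReal_sum_of_nonneg fun j _ => h0 _ j]
        exact Finset.sum_congr rfl fun j _ => hM ⟨i, hi⟩ j]
      exact ENNReal.ofReal_le_of_le_toReal this
    · simp [hrow0 i _ hi]
  · intro j
    by_cases hj : j < n
    · rw [hC]
      have := h3 ⟨j, hj⟩
      rw [show ∑ i : Fin n, M i j = ENNReal.ofReal (∑ i, m i ⟨j, hj⟩) by
        rw [ENNReal.ofReal_sum_of_nonneg fun i _ => h0 i _]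
        exact Finset.sum_congr rfl fun i _ => hM i ⟨j, hj⟩]
      exact ENNReal.ofReal_le_of_le_toReal this
    · simp [hcol0 _ j hj]
  · rw [tsum_eq_sum (s := Finset.range n) (by
      intro i hi
      simp [hrow0 i _ (by simpa using hi)]), Finset.sum_range, Finset.sum_range]
    simp only [hR, hM]
    refine (ENNReal.ofReal_le_ofReal h4).trans (le_of_eq ?_)
    rw [ENNReal.ofReal_sum_of_nonneg fun i _ => Finset.sum_nonneg fun j _ => h0 i j]
    exact Finset.sum_congr rfl fun i _ => ENNReal.ofReal_sum_of_nonneg fun j _ => h0 i j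

lemma meas_eq_tsum_fibers {Ω : Type*} [MeasurableSpace Ω] (P : Measure Ω) (Z : Ω → ℕ)
    (hZ : Measurable Z) (B : Set Ω) (hB : MeasurableSet B) :
    P B = ∑' k, P (Z ⁻¹' {k} ∩ B) := by
  rw [← measure_iUnion]
  · congr 1; ext w; simp
  · intro i j hij
    rw [Function.onFun, Set.disjoint_left]
    rintro w ⟨h1, -⟩ ⟨h2, -⟩
    exact hij ((show Z w = i from h1).symm.trans h2)
  · exact fun k => (hZ (measurableSet_singleton k)).inter hB

lemma assemble {Ω S : Type*} [MeasurableSpace Ω] [MeasurableSpace S] [StandardBorelSpace S]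
    (P : Measure Ω) [IsProbabilityMeasure P] (hna : Nonatomic P)
    (X Y : Ω → S) (hX : Measurable X) (hY : Measurable Y)
    (idx : S → ℕ) (hidx : Measurable idx) (M : ℕ → ℕ → ℝ≥0∞)
    (hrow : ∀ i, ∑' j, M i j ≤ P (X ⁻¹' (idx ⁻¹' {i})))
    (hcol : ∀ j, ∑' i, M i j ≤ P (Y ⁻¹' (idx ⁻¹' {j}))) :
    ∃ Y' : Ω → S, Measurable Y' ∧ P.map Y' = P.map Y ∧
      P {w | M (idx (X w)) (idx (Y' w)) = 0} ≤ 1 - ∑' i, ∑' j, M i j := by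
  have : Nonempty Ω := by
    by_contra hne
    rw [not_nonempty_iff] at hne
    have := measure_univ (μ := P)
    rw [univ_eq_empty_iff.mpr hne] at this
    simp at this
  have : Nonempty S := ⟨X (Classical.arbitrary Ω)⟩
  let Z : Ω → ℕ := fun w => idx (X w)
  have hZ : Measurable Z := hidx.comp hX
  let wt : ℕ → ℕ → ℝ≥0∞ := fun i k =>
    Nat.casesOn k (P (Z ⁻¹' {i}) - ∑' j, M i j) (fun j => M i j)
  obtain ⟨J, hJ, hJP⟩ := na_glue P hna Z hZ
    (fun i => Measure.sum (fun k => wt i k • Measure.dirac k)) (by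
      intro i
      rw [Measure.sum_apply _ MeasurableSet.univ]
      simp only [Measure.smul_apply, measure_univ, smul_eq_mul, mul_one]
      rw [tsum_eq_zero_add' ENNReal.summable]
      exact tsub_add_cancel_of_le (hrow i))
  have hJw : ∀ i k, P (Z ⁻¹' {i} ∩ J ⁻¹' {k}) = wt i k := by
    intro i k
    rw [hJP i {k} (measurableSet_singleton k), Measure.sum_apply _ (measurableSet_singleton k)]
    rw [tsum_eq_single k]
    · simp
    · intro k' hk
      simp [hk]
  let c : ℕ → ℝ≥0∞ := fun j => ∑' i, M i j
  have hJc : ∀ j, P (J ⁻¹' {j + 1}) = c j := by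
    intro j
    rw [meas_eq_tsum_fibers P Z hZ _ (hJ (measurableSet_singleton _))]
    simp only [hJw]
    rfl
  let b : ℕ → ℝ≥0∞ := fun j => P (Y ⁻¹' (idx ⁻¹' {j}))
  have hcb : ∀ j, c j / b j ≤ 1 := fun j => ENNReal.div_le_of_le_mul (by simpa using hcol j)
  let ν := P.map Y
  have hν : IsProbabilityMeasure ν := Measure.isProbabilityMeasure_map hY.aemeasurable
  have hEm : ∀ j, MeasurableSet (idx ⁻¹' {j}) := fun j => hidx (measurableSet_singleton j)
  have hνE : ∀ j, ν (idx ⁻¹' {j}) = b j := fun j => Measure.map_apply hY (hEm j)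
  let κ : ℕ → Measure S := fun k =>
    Nat.casesOn k (Measure.sum fun j => (1 - c j / b j) • ν.restrict (idx ⁻¹' {j}))
      (fun j => (c j / b j) • ν.restrict (idx ⁻¹' {j}))
  have hκs : ∀ j, κ (j + 1) = (c j / b j) • ν.restrict (idx ⁻¹' {j}) := fun j => rfl
  have hκ0 : κ 0 = Measure.sum fun j => (1 - c j / b j) • ν.restrict (idx ⁻¹' {j}) := rfl
  have hκsum : ∀ B, MeasurableSet B → ∑' k, κ k B = ν B := by
    intro B hB
    rw [tsum_eq_zero_add' ENNReal.summable, hκ0, Measure.sum_apply _ hB, ← ENNReal.tsum_add,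
      meas_eq_tsum_fibers ν idx hidx B hB]
    refine tsum_congr fun j => ?_
    rw [hκs, Measure.smul_apply, Measure.smul_apply, smul_eq_mul, smul_eq_mul, ← add_mul,
      tsub_add_cancel_of_le (hcb j), one_mul, Measure.restrict_apply hB, inter_comm]
  have hκsu : ∀ j, κ (j + 1) univ = c j := by
    intro j
    rw [hκs, Measure.smul_apply, Measure.restrict_apply_univ, hνE, smul_eq_mul]
    by_cases h0 : b j = 0
    · rw [h0, mul_zero]
      have := hcol j
      rw [show P (Y ⁻¹' (idx ⁻¹' {j})) = 0 from h0] at this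
      exact (le_antisymm this bot_le).symm
    · exact ENNReal.div_mul_cancel h0 (measure_ne_top _ _)
  have hJ0 : P (J ⁻¹' {0}) + ∑' j, c j = 1 := by
    have := meas_eq_tsum_fibers P J hJ univ MeasurableSet.univ
    rw [tsum_eq_zero_add' ENNReal.summable, measure_univ] at this
    simp only [inter_univ, hJc] at this
    exact this.symm
  have hcf : ∑' j, c j ≠ ∞ := by
    intro h
    rw [h] at hJ0
    simp at hJ0
  have hκ0u : κ 0 univ = P (J ⁻¹' {0}) := by
    have := hκsum univ MeasurableSet.univ
    rw [tsum_eq_zero_add' ENNReal.summable, measure_univ (μ := ν), ← hJ0] at this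
    simp only [hκsu] at this
    exact (ENNReal.add_left_inj hcf).mp this
  obtain ⟨Y', hY', hYP⟩ := na_glue P hna J hJ κ (by
    intro k
    cases k with
    | zero => exact hκ0u
    | succ j => rw [hκsu, hJc])
  refine ⟨Y', hY', ?_, ?_⟩
  · ext B hB
    rw [← hκsum B hB, Measure.map_apply hY' hB, meas_eq_tsum_fibers P J hJ _ (hY' hB)]
    exact tsum_congr fun k => hYP k B hB
  · have hsub : {w | M (idx (X w)) (idx (Y' w)) = 0} ⊆ J ⁻¹' {0} ∪
        ((⋃ j, J ⁻¹' {j + 1} ∩ Y' ⁻¹' (idx ⁻¹' {j})ᶜ) ∪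
         ⋃ i, ⋃ j, ⋃ _ : M i j = 0, Z ⁻¹' {i} ∩ J ⁻¹' {j + 1}) := by
      intro w hw
      have hw : M (idx (X w)) (idx (Y' w)) = 0 := hw
      rcases hk : J w with _ | j
      · left; exact hk
      · right
        by_cases hj : idx (Y' w) = j
        · right
          simp only [mem_iUnion]
          exact ⟨idx (X w), j, by rw [← hj]; exact hw, rfl, hk⟩
        · left
          simp only [mem_iUnion]
          exact ⟨j, hk, hj⟩
    have hz1 : P (⋃ j, J ⁻¹' {j + 1} ∩ Y' ⁻¹' (idx ⁻¹' {j})ᶜ) = 0 := by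
      rw [measure_iUnion_null_iff]
      intro j
      rw [hYP _ _ (hEm j).compl, hκs, Measure.smul_apply, Measure.restrict_apply (hEm j).compl]
      simp
    have hz2 : P (⋃ i, ⋃ j, ⋃ _ : M i j = 0, Z ⁻¹' {i} ∩ J ⁻¹' {j + 1}) = 0 := by
      simp only [measure_iUnion_null_iff]
      intro i j h0
      rw [hJw]; exact h0
    calc P {w | M (idx (X w)) (idx (Y' w)) = 0} ≤ P (J ⁻¹' {0}) := by
          refine (measure_mono hsub).trans ?_
          refine (measure_union_le _ _).trans ?_
          rw [measure_union_null hz1 hz2, add_zero]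
      _ = 1 - ∑' i, ∑' j, M i j := by
          rw [ENNReal.tsum_comm]
          exact ENNReal.eq_sub_of_add_eq hcf hJ0

lemma exists_large {S : Type*} [MeasurableSpace S] (μ : Measure S) [IsProbabilityMeasure μ]
    (idx : S → ℕ) (hidx : Measurable idx) (δ : ℝ) (hδ : 0 < δ) :
    ∃ n₀, ∀ n ≥ n₀, μ.real {s | n ≤ idx s} ≤ δ := by
  have h : Tendsto (fun n : ℕ => μ {s | n ≤ idx s}) atTop (𝓝 (μ (⋂ n : ℕ, {s | n ≤ idx s}))) := by
    refine tendsto_measure_iInter_atTop (fun n => ?_) ?_ ⟨0, measure_ne_top _ _⟩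
    · exact (hidx measurableSet_Ici).nullMeasurableSet
    · intro m n hmn s hs
      exact le_trans hmn hs
  have h0 : (⋂ n : ℕ, {s | n ≤ idx s}) = ∅ := by
    ext s
    simp only [mem_iInter, mem_empty_iff_false, iff_false, not_forall]
    exact ⟨idx s + 1, fun h => by have : idx s + 1 ≤ idx s := h; omega⟩
  rw [h0, measure_empty] at h
  have h1 := h.eventually (gt_mem_nhds (ENNReal.ofReal_pos.mpr hδ))
  obtain ⟨n₀, hn⟩ := eventually_atTop.mp h1
  exact ⟨n₀, fun n hle => ENNReal.toReal_le_of_le_ofReal hδ.le (hn n hle).le⟩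

/-- If `q(law X, law Y) < ε` on a nonatomic probability space, then there exists `Y'` with
`law Y' = law Y` and `ρ(X, Y') < ε`. -/
theorem stmt4 {Ω S : Type*} [MeasurableSpace Ω] [MeasurableSpace S] [MetricSpace S]
    [BorelSpace S] [CompleteSpace S] [TopologicalSpace.SeparableSpace S]
    (P : Measure Ω) [IsProbabilityMeasure P] (hna : Nonatomic P)
    (X Y : Ω → S) (hX : Measurable X) (hY : Measurable Y)
    {ε : ℝ} (hq : levyProkhorovDist (P.map X) (P.map Y) < ε) :
    ∃ Y' : Ω → S, Measurable Y' ∧ P.map Y' = P.map Y ∧ kyFanDist P X Y' < ε := by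
  classical
  obtain ⟨η, hqη, hηε⟩ := exists_between hq
  have hη : 0 < η := lt_of_le_of_lt ENNReal.toReal_nonneg hqη
  let δ : ℝ := (ε - η) / 4
  have hδ : 0 < δ := by simp only [δ]; linarith
  have hδε : η + 3 * δ < ε := by simp only [δ]; linarith
  have hSC : SecondCountableTopology S := UniformSpace.secondCountable_of_separable S
  obtain ⟨E, hEm, hEb, hEd, hEU, hEdis⟩ := SeparableSpace.exists_measurable_partition_diam_le S hδ
  have hex : ∀ s : S, ∃ k, s ∈ E k := fun s => by
    have : s ∈ ⋃ k, E k := by rw [hEU]; trivial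
    simpa using this
  choose idx hidxE using hex
  have hidx_iff : ∀ s k, idx s = k ↔ s ∈ E k := by
    intro s k
    constructor
    · rintro rfl; exact hidxE s
    · intro hs
      by_contra hne
      exact Set.disjoint_left.mp (hEdis hne) (hidxE s) hs
  have hpre : ∀ k, idx ⁻¹' {k} = E k := by
    intro k; ext s; exact hidx_iff s k
  have hidx : Measurable idx := measurable_to_countable' fun k => by rw [hpre]; exact hEm k
  let μ := P.map X
  let ν := P.map Y
  have hμ : IsProbabilityMeasure μ := Measure.isProbabilityMeasure_map hX.aemeasurable
  have hν : IsProbabilityMeasure ν := Measure.isProbabilityMeasure_map hY.aemeasurable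
  obtain ⟨n₁, hn₁⟩ := exists_large μ idx hidx (δ / 2) (by positivity)
  obtain ⟨n₂, hn₂⟩ := exists_large ν idx hidx (δ / 2) (by positivity)
  let n := max n₁ n₂
  have hμn := hn₁ n (le_max_left _ _)
  have hνn := hn₂ n (le_max_right _ _)
  let r : ℕ → ℕ → Prop := fun i j => ∃ x ∈ E i, ∃ y ∈ E j, dist x y < η
  have hLP : levyProkhorovEDist μ ν < ENNReal.ofReal η := by
    rw [ENNReal.lt_ofReal_iff_toReal_lt (levyProkhorovEDist_ne_top μ ν)]
    exact hqη
  have hsumE : ∀ (ρ : Measure S) [IsProbabilityMeasure ρ] (I : Finset ℕ),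
      ρ.real (⋃ i ∈ I, E i) = ∑ i ∈ I, (ρ (E i)).toReal := by
    intro ρ _ I
    rw [measureReal_biUnion_finset (fun i _ j _ hij => hEdis hij) (fun i _ => hEm i)]
    rfl
  obtain ⟨M, hMr, hMrow, hMcol, hMtot⟩ := frac_hall' n (fun i => μ (E i)) (fun j => ν (E j))
    (fun i => measure_ne_top _ _) (fun j => measure_ne_top _ _) r (η + δ / 2) (by positivity) (by
      intro I hI
      rw [← hsumE, ← hsumE]
      have hB : MeasurableSet (⋃ i ∈ I, E i) := I.measurableSet_biUnion fun i _ => hEm i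
      have h1 := left_measure_le_of_levyProkhorovEDist_lt hLP hB
      rw [ENNReal.toReal_ofReal hη.le] at h1
      have h2 : μ.real (⋃ i ∈ I, E i) ≤ ν.real (Metric.thickening η (⋃ i ∈ I, E i)) + η := by
        have := ENNReal.toReal_mono (by finiteness) h1
        rwa [ENNReal.toReal_add (measure_ne_top _ _) (by finiteness),
          ENNReal.toReal_ofReal hη.le] at this
      have h3 : Metric.thickening η (⋃ i ∈ I, E i) ⊆
          (⋃ j ∈ (Finset.range n).filter (fun j => ∃ i ∈ I, r i j), E j) ∪ {s | n ≤ idx s} := by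
        intro y hy
        by_cases hyn : n ≤ idx y
        · exact Or.inr hyn
        · left
          rw [Metric.mem_thickening_iff] at hy
          obtain ⟨x, hx, hd⟩ := hy
          simp only [mem_iUnion] at hx ⊢
          obtain ⟨i, hi, hxi⟩ := hx
          refine ⟨idx y, ?_, hidxE y⟩
          simp only [Finset.mem_filter, Finset.mem_range]
          exact ⟨by omega, i, hi, x, hxi, y, hidxE y, by rwa [dist_comm]⟩
      have h4 := (measureReal_mono (μ := ν) h3).trans (measureReal_union_le _ _)
      linarith) (δ / 2) (by positivity)
  obtain ⟨Y', hY', hlaw, hbad⟩ := assemble P hna X Y hX hY idx hidx M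
    (by intro i; rw [hpre, ← Measure.map_apply hX (hEm i)]; exact hMrow i)
    (by intro i; rw [hpre, ← Measure.map_apply hY (hEm i)]; exact hMcol i)
  refine ⟨Y', hY', hlaw, lt_of_le_of_lt (csInf_le ⟨0, fun x hx => hx.1.le⟩ ?_) hδε⟩
  refine ⟨by positivity, ?_⟩
  have htot : 1 - δ / 2 ≤ ∑ i ∈ Finset.range n, (μ (E i)).toReal := by
    rw [← hsumE]
    have : (univ : Set S) ⊆ (⋃ i ∈ Finset.range n, E i) ∪ {s | n ≤ idx s} := by
      intro s _
      by_cases hs : n ≤ idx s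
      · exact Or.inr hs
      · left
        simp only [mem_iUnion, Finset.mem_range]
        exact ⟨idx s, by omega, hidxE s⟩
    have h4 := (measureReal_mono (μ := μ) this).trans (measureReal_union_le _ _)
    rw [probReal_univ] at h4
    linarith
  have hsub : {w | η + 3 * δ ≤ dist (X w) (Y' w)} ⊆ {w | M (idx (X w)) (idx (Y' w)) = 0} := by
    intro w hw
    by_contra hne
    obtain ⟨x, hx, y, hy, hxy⟩ := hMr _ _ hne
    have h1 : dist (X w) x ≤ δ :=
      (Metric.dist_le_diam_of_mem (hEb _) (hidxE (X w)) hx).trans (hEd _)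
    have h2 : dist y (Y' w) ≤ δ :=
      (Metric.dist_le_diam_of_mem (hEb _) hy (hidxE (Y' w))).trans (hEd _)
    have h3 := dist_triangle4 (X w) x y (Y' w)
    have hw : η + 3 * δ ≤ dist (X w) (Y' w) := hw
    linarith
  refine ENNReal.toReal_le_of_le_ofReal (by positivity) ?_
  refine (measure_mono hsub).trans (hbad.trans ?_)
  rw [tsub_le_iff_right]
  calc (1 : ℝ≥0∞) = ENNReal.ofReal 1 := by simp
    _ ≤ ENNReal.ofReal ((η + 3 * δ) +
        (∑ i ∈ Finset.range n, (μ (E i)).toReal - (η + δ / 2) - δ / 2)) :=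
      ENNReal.ofReal_le_ofReal (by linarith)
    _ ≤ _ := ENNReal.ofReal_add_le.trans (by gcongr)
end

section
/- Let β : [0,1] → P(S) be a polygonal path with vertices at finitely supported measures, with β(0) = μ and β(1) = ν. Given random variables X_μ, X_ν on a complete nonatomic probability space with law(X_μ) = μ and law(X_ν) = ν, there exists a continuous path β̂ : [0,1] → L⁰(Ω,S) with β̂(0) = X_μ, β̂(1) = X_ν, and law(β̂(t)) = β(t) for all t. -/
open MeasureTheory Filter Topology Set
open scoped ENNReal NNReal

/-- Every nonempty set in a nice linear order has a countable cofinal monotone sequence. -/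
lemma exists_cofinal_seq {α : Type*} [CompleteLinearOrder α] [TopologicalSpace α]
    [OrderTopology α] [FirstCountableTopology α] (T : Set α) (hT : T.Nonempty) :
    ∃ u : ℕ → α, Monotone u ∧ (∀ n, u n ∈ T) ∧ ∀ x ∈ T, ∃ n, x ≤ u n := by
  by_cases h : sSup T ∈ T
  · exact ⟨fun _ => sSup T, monotone_const, fun _ => h, fun x hx => ⟨0, le_sSup hx⟩⟩
  · obtain ⟨u, hu, -, hlim, hmem⟩ := (isLUB_sSup T).exists_seq_monotone_tendsto hT
    refine ⟨u, hu, hmem, fun x hx => ?_⟩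
    have hlt : x < sSup T := lt_of_le_of_ne (le_sSup hx) (fun e => h (e ▸ hx))
    obtain ⟨n, hn⟩ := (hlim.eventually (lt_mem_nhds hlt)).exists
    exact ⟨n, hn.le⟩

/-- A chain of measurable subsets of `A` realising every measure value. -/
lemma exists_full_chain {Ω : Type*} [MeasurableSpace Ω] (P : Measure Ω) [IsProbabilityMeasure P]
    (hna : Nonatomic P) (A : Set Ω) (hA : MeasurableSet A) :
    ∃ C : Set (Set Ω), (∀ D ∈ C, MeasurableSet D ∧ D ⊆ A) ∧
      (∀ D ∈ C, ∀ E ∈ C, P D ≤ P E → D ⊆ E) ∧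
      ∀ x ≤ P A, ∃ D ∈ C, P D = x := by
  let Q := {B : Set Ω // MeasurableSet B ∧ B ⊆ A}
  let r : Q → Q → Prop := fun B D => B.1 ⊆ D.1 ∧ P B.1 < P D.1
  obtain ⟨hch, hmax⟩ := maxChain_spec (r := r)
  set C : Set (Set Ω) := Subtype.val '' (maxChain r) with hCdef
  have hCm : ∀ D ∈ C, MeasurableSet D ∧ D ⊆ A := by
    rintro _ ⟨D, -, rfl⟩; exact D.2
  have hCc : ∀ D ∈ C, ∀ E ∈ C, P D ≤ P E → D ⊆ E := by
    rintro _ ⟨D, hD, rfl⟩ _ ⟨E, hE, rfl⟩ hle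
    by_cases h : D = E
    · rw [h]
    · rcases hch hD hE h with h | h
      · exact h.1
      · exact absurd h.2 (not_lt.2 hle)
  have hCmax : ∀ M, MeasurableSet M → M ⊆ A →
      (∀ D ∈ C, (D ⊆ M ∧ P D < P M) ∨ (M ⊆ D ∧ P M < P D)) → False := by
    intro M hM hMA hall
    have h1 : IsChain r (insert (⟨M, hM, hMA⟩ : Q) (maxChain r)) := by
      apply hch.insert
      intro b hb _
      rcases hall b.1 ⟨b, hb, rfl⟩ with h | h
      · exact Or.inr h
      · exact Or.inl h
    have h2 := hmax h1 (subset_insert _ _)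
    have h3 : M ∈ C := ⟨⟨M, hM, hMA⟩, by rw [h2]; exact mem_insert _ _, rfl⟩
    rcases hall M h3 with h | h
    · exact lt_irrefl _ h.2
    · exact lt_irrefl _ h.2
  refine ⟨C, hCm, hCc, fun x hx => ?_⟩
  by_contra hno
  push Not at hno
  -- lower set
  have hL : ∃ L, MeasurableSet L ∧ L ⊆ A ∧ P L ≤ x ∧ (∀ D ∈ C, P D < x → D ⊆ L) ∧
      (∀ D ∈ C, x < P D → L ⊆ D) := by
    by_cases hne : ((fun D => P D) '' {D | D ∈ C ∧ P D < x}).Nonempty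
    · obtain ⟨u, humono, humem, hucof⟩ := exists_cofinal_seq _ hne
      choose B hB hBu using humem
      simp only at hBu
      refine ⟨⋃ n, B n, MeasurableSet.iUnion fun n => (hCm _ (hB n).1).1,
        iUnion_subset fun n => (hCm _ (hB n).1).2, ?_, ?_, ?_⟩
      · have hmono : Monotone B := fun m n hmn =>
          hCc _ (hB m).1 _ (hB n).1 (by rw [hBu, hBu]; exact humono hmn)
        rw [hmono.measure_iUnion]
        exact iSup_le fun n => (hB n).2.le
      · intro D hD hDx
        obtain ⟨n, hn⟩ := hucof (P D) ⟨D, ⟨hD, hDx⟩, rfl⟩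
        exact (hCc _ hD _ (hB n).1 (by rw [hBu]; exact hn)).trans (subset_iUnion _ _)
      · intro D hD hDx
        exact iUnion_subset fun n => hCc _ (hB n).1 _ hD ((hB n).2.trans hDx).le
    · refine ⟨∅, MeasurableSet.empty, empty_subset _, by simp, ?_, fun _ _ _ => empty_subset _⟩
      intro D hD hDx
      exact absurd ⟨_, D, ⟨hD, hDx⟩, rfl⟩ hne
  obtain ⟨L, hLm, hLA, hLx, hLlow, hLup⟩ := hL
  have hU : ∃ U, MeasurableSet U ∧ U ⊆ A ∧ L ⊆ U ∧ x ≤ P U ∧ (∀ D ∈ C, x < P D → U ⊆ D) ∧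
      (∀ D ∈ C, P D < x → D ⊆ U) := by
    by_cases hne : ((fun D => P D) '' {D | D ∈ C ∧ x < P D}).Nonempty
    · obtain ⟨u, humono, humem, hucof⟩ := exists_cofinal_seq (α := ℝ≥0∞ᵒᵈ) _ hne
      choose B hB hBu using humem
      simp only at hBu
      refine ⟨⋂ n, B n, MeasurableSet.iInter fun n => (hCm _ (hB n).1).1,
        (iInter_subset _ 0).trans (hCm _ (hB 0).1).2,
        subset_iInter fun n => hLup _ (hB n).1 (hB n).2, ?_, ?_, ?_⟩
      · have hmono : Antitone B := fun m n hmn =>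
          hCc _ (hB n).1 _ (hB m).1 (by
            have := humono hmn
            rw [← hBu, ← hBu] at this
            exact this)
        rw [hmono.measure_iInter (fun n => (hCm _ (hB n).1).1.nullMeasurableSet)
          ⟨0, measure_ne_top _ _⟩]
        exact le_iInf fun n => (hB n).2.le
      · intro D hD hDx
        obtain ⟨n, hn⟩ := hucof (P D) ⟨D, ⟨hD, hDx⟩, rfl⟩
        rw [← hBu] at hn
        exact (iInter_subset _ n).trans (hCc _ (hB n).1 _ hD hn)
      · intro D hD hDx
        exact subset_iInter fun n => hCc _ hD _ (hB n).1 (hDx.trans (hB n).2).le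
    · refine ⟨A, hA, le_rfl, hLA, hx, ?_, fun D hD _ => (hCm D hD).2⟩
      intro D hD hDx
      exact absurd ⟨_, D, ⟨hD, hDx⟩, rfl⟩ hne
  obtain ⟨U, hUm, hUA, hLU, hUx, hUup, hUlow⟩ := hU
  have hcase : ∀ D ∈ C, P D < x ∨ x < P D := fun D hD => lt_or_gt_of_ne (hno D hD)
  have hLlt : P L < x := by
    refine lt_of_le_of_ne hLx fun e => hCmax L hLm hLA fun D hD => ?_
    rcases hcase D hD with h | h
    · exact Or.inl ⟨hLlow D hD h, e ▸ h⟩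
    · exact Or.inr ⟨hLup D hD h, e ▸ h⟩
  have hUlt : x < P U := by
    refine lt_of_le_of_ne hUx fun e => hCmax U hUm hUA fun D hD => ?_
    rcases hcase D hD with h | h
    · exact Or.inl ⟨hUlow D hD h, e ▸ h⟩
    · exact Or.inr ⟨hUup D hD h, e ▸ h⟩
  have hdiff : P L + P (U \ L) = P U := by
    rw [← measure_diff_add_inter U hLm, inter_eq_right.2 hLU, add_comm]
  have hpos : 0 < P (U \ L) := by
    rw [pos_iff_ne_zero]
    intro h0
    rw [h0, add_zero] at hdiff
    exact absurd (hLlt.trans hUlt) (by rw [hdiff]; exact lt_irrefl _)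
  obtain ⟨B, hBsub, hBm, hB0, hBlt⟩ := hna _ (hUm.diff hLm) hpos
  have hM : P (L ∪ B) = P L + P B :=
    measure_union (disjoint_of_subset_right hBsub disjoint_sdiff_right) hBm
  have h1 : P L < P (L ∪ B) := by
    rw [hM]; exact ENNReal.lt_add_right (measure_ne_top _ _) hB0.ne'
  have h2 : P (L ∪ B) < P U := by
    rw [hM, ← hdiff]; exact ENNReal.add_lt_add_left (measure_ne_top _ _) hBlt
  have hBU : L ∪ B ⊆ U := union_subset hLU (hBsub.trans diff_subset)
  refine hCmax (L ∪ B) (hLm.union hBm) (hBU.trans hUA) fun D hD => ?_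
  rcases hcase D hD with h | h
  · have := hLlow D hD h
    exact Or.inl ⟨this.trans subset_union_left, (measure_mono this).trans_lt h1⟩
  · have := hUup D hD h
    exact Or.inr ⟨hBU.trans this, h2.trans_le (measure_mono this)⟩

lemma exists_nest {Ω : Type*} [MeasurableSpace Ω] (P : Measure Ω) [IsProbabilityMeasure P]
    (hna : Nonatomic P) (A : Set Ω) (hA : MeasurableSet A) :
    ∃ B : ℝ → Set Ω, (∀ r, MeasurableSet (B r)) ∧ Monotone B ∧ B 0 = ∅ ∧ B 1 = A ∧
      (∀ r, B r ⊆ A) ∧ ∀ r ∈ Icc (0 : ℝ) 1, P (B r) = ENNReal.ofReal r * P A := by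
  obtain ⟨C, hCm, hCc, hCv⟩ := exists_full_chain P hna A hA
  have h : ∀ r : ℝ, ∃ D ∈ C, P D = ENNReal.ofReal (min r 1) * P A := fun r => by
    apply hCv
    calc _ ≤ 1 * P A := by
          gcongr
          exact ENNReal.ofReal_le_one.2 (min_le_right _ _)
      _ = P A := one_mul _
  choose D hD hDP using h
  refine ⟨fun r => if r ≤ 0 then ∅ else if 1 ≤ r then A else D r, ?_, ?_, ?_, ?_, ?_, ?_⟩
  · intro r
    dsimp only
    split_ifs
    exacts [MeasurableSet.empty, hA, (hCm _ (hD r)).1]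
  · intro r s hrs
    dsimp only
    by_cases h1 : r ≤ 0
    · simp [h1]
    by_cases h2 : 1 ≤ s
    · rw [if_neg h1, if_neg (by linarith : ¬ s ≤ 0), if_pos h2]
      split_ifs
      exacts [le_rfl, (hCm _ (hD r)).2]
    · rw [if_neg h1, if_neg (by linarith : ¬ s ≤ 0), if_neg h2, if_neg (by linarith)]
      apply hCc _ (hD r) _ (hD s)
      rw [hDP, hDP]
      gcongr
  · simp
  · norm_num
  · intro r
    dsimp only
    split_ifs
    exacts [empty_subset _, le_rfl, (hCm _ (hD r)).2]
  · intro r hr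
    dsimp only
    split_ifs with h1 h2
    · simp [le_antisymm h1 hr.1]
    · simp [le_antisymm hr.2 h2]
    · rw [hDP, min_eq_left hr.2]

/-- A random variable with a prescribed finitely supported law. -/
lemma exists_rv_aux {Ω S : Type*} [MeasurableSpace Ω] [MeasurableSpace S]
    (P : Measure Ω) [IsProbabilityMeasure P] (hna : Nonatomic P) (X0 : Ω → S)
    (hX0 : Measurable X0) (n : ℕ) :
    ∀ (c : Fin n → ℝ≥0∞) (a : Fin n → S) (A : Set Ω), MeasurableSet A → P A = ∑ i, c i →
      ∃ X : Ω → S, Measurable X ∧ (P.restrict A).map X = ∑ i, c i • Measure.dirac (a i) := by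
  induction n with
  | zero =>
    intro c a A hA hPA
    refine ⟨X0, hX0, ?_⟩
    have : P A = 0 := by simpa using hPA
    simp [Measure.restrict_eq_zero.2 this]
  | succ n ih =>
    intro c a A hA hPA
    obtain ⟨C, hCm, -, hCv⟩ := exists_full_chain P hna A hA
    rw [Fin.sum_univ_succ] at hPA
    obtain ⟨B, hBC, hPB⟩ := hCv (c 0) (by rw [hPA]; exact le_self_add)
    obtain ⟨hBm, hBA⟩ := hCm B hBC
    have hdiff : P (A \ B) = ∑ i : Fin n, c i.succ := by
      rw [measure_diff hBA hBm.nullMeasurableSet (measure_ne_top _ _), hPA, hPB]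
      exact ENNReal.add_sub_cancel_left (hPB ▸ measure_ne_top P B)
    obtain ⟨X, hX, hXl⟩ := ih (fun i => c i.succ) (fun i => a i.succ) (A \ B) (hA.diff hBm) hdiff
    classical
    refine ⟨B.piecewise (fun _ => a 0) X, Measurable.piecewise hBm measurable_const hX, ?_⟩
    have hZ : Measurable (B.piecewise (fun _ => a 0) X) :=
      Measurable.piecewise hBm measurable_const hX
    have hr : P.restrict A = P.restrict B + P.restrict (A \ B) := by
      rw [← Measure.restrict_union disjoint_sdiff_right (hA.diff hBm), union_diff_cancel hBA]
    rw [hr, Measure.map_add _ _ hZ, Fin.sum_univ_succ, ← hXl]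
    congr 1
    · rw [Measure.map_congr (g := fun _ => a 0), Measure.map_const]
      · simp [hPB]
      · filter_upwards [ae_restrict_mem hBm] with ω hω
        simp [hω]
    · apply Measure.map_congr
      filter_upwards [ae_restrict_mem (hA.diff hBm)] with ω hω
      simp [hω.2]

lemma exists_rv {Ω S : Type*} [MeasurableSpace Ω] [MeasurableSpace S]
    (P : Measure Ω) [IsProbabilityMeasure P] (hna : Nonatomic P) (X0 : Ω → S)
    (hX0 : Measurable X0) (μ : Measure S) (hμ : FinitelySupported μ) :
    ∃ X : Ω → S, Measurable X ∧ P.map X = μ := by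
  obtain ⟨n, c, a, hc, rfl⟩ := hμ
  obtain ⟨X, hX, h⟩ := exists_rv_aux P hna X0 hX0 n c a univ MeasurableSet.univ (by simp [hc])
  exact ⟨X, hX, by simpa using h⟩

lemma exists_indep_nest {Ω ι : Type*} [MeasurableSpace Ω] (P : Measure Ω) [IsProbabilityMeasure P]
    (hna : Nonatomic P) [Finite ι] (f : Ω → ι) (hf : ∀ i, MeasurableSet (f ⁻¹' {i})) :
    ∃ B : ℝ → Set Ω, (∀ r, MeasurableSet (B r)) ∧ Monotone B ∧ B 0 = ∅ ∧ B 1 = univ ∧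
      ∀ r ∈ Icc (0 : ℝ) 1, ∀ C : Set ι,
        P (f ⁻¹' C ∩ B r) = ENNReal.ofReal r * P (f ⁻¹' C) := by
  choose B hBm hBmono hB0 hB1 hBsub hBP using fun i => exists_nest P hna _ (hf i)
  refine ⟨fun r => ⋃ i, B i r, fun r => MeasurableSet.iUnion fun i => hBm i r,
    fun r s hrs => iUnion_mono fun i => hBmono i hrs, by simp [hB0], ?_, ?_⟩
  · simp only [hB1]
    ext ω; simp
  · intro r hr C
    have h1 : f ⁻¹' C ∩ ⋃ i, B i r = ⋃ i : C, B i r := by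
      ext ω
      simp only [mem_inter_iff, mem_preimage, mem_iUnion]
      constructor
      · rintro ⟨hC, i, hi⟩
        have : f ω = i := hBsub i r hi
        exact ⟨⟨i, this ▸ hC⟩, hi⟩
      · rintro ⟨i, hi⟩
        have : f ω = i := hBsub i r hi
        exact ⟨this ▸ i.2, i, hi⟩
    have h2 : f ⁻¹' C = ⋃ i : C, f ⁻¹' {i.1} := by
      ext ω; simp
    have hd : Pairwise (Function.onFun Disjoint fun i : C => f ⁻¹' {i.1}) := by
      intro i j hij
      rw [Function.onFun, Set.disjoint_left]
      intro ω hi hj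
      exact hij (Subtype.ext (hi.symm.trans hj))
    rw [h1, h2, measure_iUnion hd (fun i => hf i), measure_iUnion (f := fun i : C => B i.1 r) ?_ (fun i => hBm i.1 r),
      ← ENNReal.tsum_mul_left]
    · exact tsum_congr fun i => hBP i r hr
    · intro i j hij
      exact (hd hij).mono (hBsub i r) (hBsub j r)

lemma FinitelySupported.exists_finset {S : Type*} [MeasurableSpace S] [MeasurableSingletonClass S]
    {μ : Measure S} (h : FinitelySupported μ) : ∃ F : Finset S, ∀ᵐ x ∂μ, x ∈ F := by
  classical
  obtain ⟨n, c, a, hc, rfl⟩ := h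
  refine ⟨Finset.univ.image a, ?_⟩
  have hm : MeasurableSet {x | ¬ x ∈ Finset.univ.image a} :=
    (Finset.measurableSet (Finset.univ.image a)).compl
  rw [ae_iff, Measure.finsetSum_apply]
  apply Finset.sum_eq_zero
  intro i _
  rw [Measure.smul_apply, Measure.dirac_apply' _ hm]
  simp

/-- A Lipschitz lift of the path `β` on `[a, b]`. -/
def HasLift {Ω S : Type*} [MeasurableSpace Ω] [MeasurableSpace S] (P : Measure Ω)
    (β : ℝ → Measure S) (a b : ℝ) (X Y : Ω → S) : Prop :=
  ∃ γ : ℝ → Ω → S, (∀ t ∈ Icc a b, Measurable (γ t)) ∧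
    (∃ K : ℝ, 0 ≤ K ∧ ∀ s ∈ Icc a b, ∀ t ∈ Icc a b, s ≤ t →
      P {ω | γ s ω ≠ γ t ω} ≤ ENNReal.ofReal (K * (t - s))) ∧
    γ a = X ∧ γ b = Y ∧ ∀ t ∈ Icc a b, P.map (γ t) = β t

lemma HasLift.trans {Ω S : Type*} [MeasurableSpace Ω] [MeasurableSpace S] {P : Measure Ω}
    {β : ℝ → Measure S} {a b c : ℝ} {X Y Z : Ω → S} (hab : a ≤ b) (hbc : b ≤ c)
    (h1 : HasLift P β a b X Y) (h2 : HasLift P β b c Y Z) : HasLift P β a c X Z := by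
  obtain ⟨γ, hm, ⟨K, hK0, hK⟩, ha, hb, hl⟩ := h1
  obtain ⟨γ', hm', ⟨K', hK0', hK'⟩, ha', hb', hl'⟩ := h2
  have e1 : ∀ t, t ≤ b → (if t ≤ b then γ t else γ' t) = γ t := fun t ht => if_pos ht
  have e2 : ∀ t, b ≤ t → (if t ≤ b then γ t else γ' t) = γ' t := fun t ht => by
    split_ifs with h
    · rw [le_antisymm h ht, hb, ha']
    · rfl
  refine ⟨fun t => if t ≤ b then γ t else γ' t, ?_, ⟨K + K', by positivity, ?_⟩, ?_, ?_, ?_⟩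
  · intro t ht
    dsimp only
    rcases le_total t b with h | h
    · rw [e1 t h]; exact hm t ⟨ht.1, h⟩
    · rw [e2 t h]; exact hm' t ⟨h, ht.2⟩
  · intro s hs t ht hst
    dsimp only
    rcases le_total t b with h | h
    · rw [e1 t h, e1 s (hst.trans h)]
      refine (hK s ⟨hs.1, hst.trans h⟩ t ⟨ht.1, h⟩ hst).trans (ENNReal.ofReal_le_ofReal ?_)
      nlinarith
    rcases le_total s b with h' | h'
    · rw [e1 s h', e2 t h]
      have hsub : {ω | γ s ω ≠ γ' t ω} ⊆ {ω | γ s ω ≠ γ b ω} ∪ {ω | γ' b ω ≠ γ' t ω} := by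
        intro ω hω
        by_contra hcon
        simp only [mem_union, mem_setOf_eq, not_or, not_not] at hcon
        apply hω
        rw [hcon.1, hb, ← hcon.2, ha']
      refine (measure_mono hsub).trans ((measure_union_le _ _).trans ?_)
      refine (add_le_add (hK s ⟨hs.1, h'⟩ b ⟨hab, le_rfl⟩ h')
        (hK' b ⟨le_rfl, hbc⟩ t ⟨h, ht.2⟩ h)).trans ?_
      rw [← ENNReal.ofReal_add (mul_nonneg hK0 (by linarith)) (mul_nonneg hK0' (by linarith))]
      apply ENNReal.ofReal_le_ofReal
      nlinarith
    · rw [e2 t h, e2 s h']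
      refine (hK' s ⟨h', hs.2⟩ t ⟨h, ht.2⟩ hst).trans (ENNReal.ofReal_le_ofReal ?_)
      nlinarith
  · dsimp only
    rw [e1 a hab, ha]
  · dsimp only
    rw [e2 c hbc, hb']
  · intro t ht
    dsimp only
    rcases le_total t b with h | h
    · rw [e1 t h]; exact hl t ⟨ht.1, h⟩
    · rw [e2 t h]; exact hl' t ⟨h, ht.2⟩

/-- A nest of sets independent of two finitely-valued random variables. -/
lemma indep_of_finite {Ω S : Type*} [MeasurableSpace Ω] [MeasurableSpace S]
    [MeasurableSingletonClass S] (P : Measure Ω) [IsProbabilityMeasure P] (hna : Nonatomic P)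
    (X Y : Ω → S) (hX : Measurable X) (hY : Measurable Y)
    (hfX : FinitelySupported (P.map X)) (hfY : FinitelySupported (P.map Y)) :
    ∃ B : ℝ → Set Ω, (∀ r, MeasurableSet (B r)) ∧ Monotone B ∧ B 0 = ∅ ∧ B 1 = univ ∧
      ∀ r ∈ Icc (0 : ℝ) 1, P (B r) = ENNReal.ofReal r ∧ ∀ E : Set S,
        P (X ⁻¹' E ∩ B r) = ENNReal.ofReal r * P (X ⁻¹' E) ∧
        P (Y ⁻¹' E ∩ B r) = ENNReal.ofReal r * P (Y ⁻¹' E) := by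
  obtain ⟨F, hF⟩ := hfX.exists_finset
  obtain ⟨G, hG⟩ := hfY.exists_finset
  replace hF := ae_of_ae_map hX.aemeasurable hF
  replace hG := ae_of_ae_map hY.aemeasurable hG
  let f : Ω → (F → Prop) × (G → Prop) := fun ω => (fun z => X ω = z, fun z => Y ω = z)
  have hf : Measurable f := by
    refine Measurable.prodMk (measurable_pi_lambda _ fun z => ?_)
      (measurable_pi_lambda _ fun z => ?_)
    · exact measurableSet_setOf.1 (hX (measurableSet_singleton z.1))
    · exact measurableSet_setOf.1 (hY (measurableSet_singleton z.1))
  obtain ⟨B, hBm, hBmono, hB0, hB1, hB⟩ :=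
    exists_indep_nest P hna f (fun i => hf (measurableSet_singleton i))
  refine ⟨B, hBm, hBmono, hB0, hB1, fun r hr => ⟨by simpa using hB r hr univ, fun E => ⟨?_, ?_⟩⟩⟩
  · have h : X ⁻¹' E =ᵐ[P] f ⁻¹' {p | ∃ z : F, z.1 ∈ E ∧ p.1 z} := by
      filter_upwards [hF] with ω hω
      apply propext
      constructor
      · intro hE
        exact ⟨⟨X ω, hω⟩, hE, rfl⟩
      · rintro ⟨z, hz, he⟩
        have he : X ω = z := he
        change X ω ∈ E
        rw [he]; exact hz
    rw [measure_congr (h.inter (ae_eq_refl (B r))), hB r hr, measure_congr h]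
  · have h : Y ⁻¹' E =ᵐ[P] f ⁻¹' {p | ∃ z : G, z.1 ∈ E ∧ p.2 z} := by
      filter_upwards [hG] with ω hω
      apply propext
      constructor
      · intro hE
        exact ⟨⟨Y ω, hω⟩, hE, rfl⟩
      · rintro ⟨z, hz, he⟩
        have he : Y ω = z := he
        change Y ω ∈ E
        rw [he]; exact hz
    rw [measure_congr (h.inter (ae_eq_refl (B r))), hB r hr, measure_congr h]

lemma hasLift_segment {Ω S : Type*} [MeasurableSpace Ω] [MeasurableSpace S]
    [MeasurableSingletonClass S] (P : Measure Ω) [IsProbabilityMeasure P] (hna : Nonatomic P)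
    (X Y : Ω → S) (hX : Measurable X) (hY : Measurable Y)
    (hfX : FinitelySupported (P.map X)) (hfY : FinitelySupported (P.map Y))
    (β : ℝ → Measure S) (a b : ℝ) (hab : a < b)
    (hβ : ∀ s ∈ Icc a b, β s = ENNReal.ofReal ((b - s) / (b - a)) • P.map X
        + ENNReal.ofReal ((s - a) / (b - a)) • P.map Y) :
    HasLift P β a b X Y := by
  classical
  obtain ⟨B, hBm, hBmono, hB0, hB1, hB⟩ := indep_of_finite P hna X Y hX hY hfX hfY
  have hba : 0 < b - a := sub_pos.2 hab
  have hr : ∀ s ∈ Icc a b, (s - a) / (b - a) ∈ Icc (0 : ℝ) 1 := fun s hs =>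
    ⟨div_nonneg (by linarith [hs.1]) hba.le, (div_le_one hba).2 (by linarith [hs.2])⟩
  have hmeas : ∀ s, Measurable ((B ((s - a) / (b - a))).piecewise Y X) := fun s =>
    Measurable.piecewise (hBm _) hY hX
  refine ⟨fun s => (B ((s - a) / (b - a))).piecewise Y X, fun s _ => hmeas s,
    ⟨1 / (b - a), by positivity, ?_⟩, ?_, ?_, ?_⟩
  · intro s hs t ht hst
    have hle : (s - a) / (b - a) ≤ (t - a) / (b - a) := by gcongr
    have hsub : {ω | (B ((s - a) / (b - a))).piecewise Y X ω ≠
        (B ((t - a) / (b - a))).piecewise Y X ω} ⊆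
        B ((t - a) / (b - a)) \ B ((s - a) / (b - a)) := by
      intro ω hω
      by_contra hcon
      apply hω
      by_cases h1 : ω ∈ B ((s - a) / (b - a))
      · simp [h1, hBmono hle h1]
      · have h2 : ω ∉ B ((t - a) / (b - a)) := fun h => hcon ⟨h, h1⟩
        simp [h1, h2]
    refine (measure_mono hsub).trans ?_
    rw [measure_diff (hBmono hle) (hBm _).nullMeasurableSet (measure_ne_top _ _),
      (hB _ (hr s hs)).1, (hB _ (hr t ht)).1, ← ENNReal.ofReal_sub _ (hr s hs).1]
    apply ENNReal.ofReal_le_ofReal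
    apply le_of_eq
    field_simp
    ring
  · funext ω
    have h : ω ∉ B ((a - a) / (b - a)) := by rw [sub_self, zero_div, hB0]; exact notMem_empty _
    exact piecewise_eq_of_notMem _ _ _ h
  · funext ω
    have h : ω ∈ B ((b - a) / (b - a)) := by rw [div_self hba.ne', hB1]; exact mem_univ _
    exact piecewise_eq_of_mem _ _ _ h
  · intro s hs
    ext E hE
    rw [Measure.map_apply (hmeas s) hE, hβ s hs]
    set r := (s - a) / (b - a) with hrdef
    have hr' : (b - s) / (b - a) = 1 - r := by rw [hrdef]; field_simp; ring
    have hrI : r ∈ Icc (0 : ℝ) 1 := hr s hs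
    rw [hr']
    simp only [Measure.add_apply, Measure.smul_apply, smul_eq_mul]
    rw [Measure.map_apply hX hE, Measure.map_apply hY hE]
    obtain ⟨hXE, hYE⟩ := (hB r hrI).2 E
    have hdX : P (X ⁻¹' E \ B r) = ENNReal.ofReal (1 - r) * P (X ⁻¹' E) := by
      have h1 := measure_inter_add_diff (μ := P) (X ⁻¹' E) (hBm r)
      have h2 : P (X ⁻¹' E) = P (X ⁻¹' E ∩ B r) + ENNReal.ofReal (1 - r) * P (X ⁻¹' E) := by
        rw [hXE, ← add_mul, ← ENNReal.ofReal_add hrI.1 (by linarith [hrI.2])]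
        simp
      exact (ENNReal.add_right_inj (measure_ne_top P (X ⁻¹' E ∩ B r))).1 (h1.trans h2)
    rw [← measure_inter_add_diff _ (hBm r), add_comm, ← hdX, ← hYE]
    congr 2
    · ext ω
      by_cases h : ω ∈ B r <;> simp [h]
    · ext ω
      by_cases h : ω ∈ B r <;> simp [h]

/-- A polygonal path of measures with finitely supported vertices can be lifted to a
continuous path of random variables with prescribed endpoints. -/
theorem stmt13 {Ω S : Type*} [MeasurableSpace Ω] [MeasurableSpace S] [MetricSpace S]
    [BorelSpace S] [CompleteSpace S] [TopologicalSpace.SeparableSpace S]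
    (P : Measure Ω) [IsProbabilityMeasure P] (hna : Nonatomic P)
    (β : ℝ → Measure S)
    (hβ : IsPolygonalWithVertices β {μ | FinitelySupported μ ∧ IsProbabilityMeasure μ})
    (Xμ Xν : Ω → S) (hXμ : Measurable Xμ) (hXν : Measurable Xν)
    (hlaw0 : P.map Xμ = β 0) (hlaw1 : P.map Xν = β 1) :
    ∃ βhat : ℝ → Ω → S,
      (∀ t ∈ Set.Icc (0 : ℝ) 1, Measurable (βhat t)) ∧
      KyFanContinuousOn P βhat (Set.Icc 0 1) ∧
      βhat 0 = Xμ ∧ βhat 1 = Xν ∧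
      ∀ t ∈ Set.Icc (0 : ℝ) 1, P.map (βhat t) = β t := by
  classical
  obtain ⟨n, t, μ, hmono, ht0, ht1, hV, hpoly⟩ := hβ
  have hvl : ∀ i : Fin (n + 1), β (t i.castSucc) = μ i.castSucc := by
    intro i
    have hlt : t i.castSucc < t i.succ := hmono Fin.castSucc_lt_succ
    rw [hpoly i _ ⟨le_rfl, hlt.le⟩, div_self (sub_pos.2 hlt).ne']
    simp
  have hvr : ∀ i : Fin (n + 1), β (t i.succ) = μ i.succ := by
    intro i
    have hlt : t i.castSucc < t i.succ := hmono Fin.castSucc_lt_succ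
    rw [hpoly i _ ⟨hlt.le, le_rfl⟩, div_self (sub_pos.2 hlt).ne']
    simp
  have hm0 : P.map Xμ = μ 0 := by
    rw [hlaw0, ← ht0]; exact hvl 0
  have hm1 : P.map Xν = μ (Fin.last (n + 1)) := by
    rw [hlaw1, ← ht1]; exact hvr (Fin.last n)
  have hX : ∃ X : Fin (n + 2) → Ω → S, X 0 = Xμ ∧ X (Fin.last (n + 1)) = Xν ∧
      ∀ i, Measurable (X i) ∧ P.map (X i) = μ i := by
    choose Z hZ hZl using fun i => exists_rv P hna Xμ hXμ (μ i) (hV i).1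
    have hne : Fin.last (n + 1) ≠ 0 := (Fin.last_pos).ne'
    refine ⟨fun i => if i = 0 then Xμ else if i = Fin.last (n + 1) then Xν else Z i,
      by simp, by simp [hne], fun i => ?_⟩
    dsimp only
    split_ifs with h1 h2
    · exact ⟨hXμ, by rw [hm0, h1]⟩
    · exact ⟨hXν, by rw [hm1, h2]⟩
    · exact ⟨hZ i, hZl i⟩
  obtain ⟨X, hX0, hX1, hXi⟩ := hX
  have hind : ∀ k : Fin (n + 2), HasLift P β (t 0) (t k) (X 0) (X k) := by
    intro k
    induction k using Fin.induction with
    | zero =>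
      refine ⟨fun _ => X 0, fun _ _ => (hXi 0).1, ⟨0, le_rfl, ?_⟩, rfl, rfl, ?_⟩
      · intro s _ t _ _
        simp
      · intro s hs
        have : s = t 0 := le_antisymm hs.2 hs.1
        rw [this, ht0, hX0, hlaw0]
    | succ i ih =>
      have hlt : t i.castSucc < t i.succ := hmono Fin.castSucc_lt_succ
      refine ih.trans (hmono.monotone (Fin.zero_le _)) hlt.le ?_
      apply hasLift_segment P hna _ _ (hXi _).1 (hXi _).1 _ _ β _ _ hlt
      · intro s hs
        rw [hpoly i s hs, (hXi _).2, (hXi _).2]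
      · rw [(hXi _).2]; exact (hV _).1
      · rw [(hXi _).2]; exact (hV _).1
  have hfin := hind (Fin.last (n + 1))
  rw [ht0, ht1, hX0, hX1] at hfin
  obtain ⟨γ, hγm, ⟨K, hK0, hK⟩, hγ0, hγ1, hγl⟩ := hfin
  refine ⟨γ, hγm, ?_, hγ0, hγ1, hγl⟩
  intro s hs ε hε
  refine ⟨ε / (2 * (K + 1)), by positivity, fun u hu hus => ?_⟩
  have hPle : P {ω | γ u ω ≠ γ s ω} ≤ ENNReal.ofReal (K * |u - s|) := by
    rcases le_total u s with h | h
    · rw [abs_sub_comm, abs_of_nonneg (sub_nonneg.2 h)]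
      exact hK u hu s hs h
    · rw [abs_of_nonneg (sub_nonneg.2 h)]
      have := hK s hs u hu h
      simpa only [ne_comm] using this
  have hKe : K * |u - s| ≤ ε / 2 := by
    rw [lt_div_iff₀ (by positivity)] at hus
    nlinarith [abs_nonneg (u - s)]
  have hmem : ε / 2 ∈ {e : ℝ | 0 < e ∧ (P {ω | e ≤ dist (γ u ω) (γ s ω)}).toReal ≤ e} := by
    refine ⟨by positivity, ENNReal.toReal_le_of_le_ofReal (by positivity) ?_⟩
    refine (measure_mono ?_).trans (hPle.trans (ENNReal.ofReal_le_ofReal hKe))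
    intro ω hω he
    rw [mem_setOf_eq, he, dist_self] at hω
    linarith
  have : kyFanDist P (γ u) (γ s) ≤ ε / 2 := csInf_le ⟨0, fun e he => he.1.le⟩ hmem
  linarith
end
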